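/- Let n ≥ 5 and 1 < p < (n+4)/(n-4). If u is a nonnegative C⁴ solution of Δ²u = u^p in all of ℝⁿ, then u ≡ 0 in ℝⁿ. -/

import Mathlib

open MeasureTheory Metric Filter

/-- The Euclidean Laplacian `Δu` of `u : ℝⁿ → ℝ`, computed as the trace of the second
derivative: `Δu(x) = ∑ i, ∂²u/∂xᵢ²(x)`. -/
noncomputable def lap {n : ℕ} (u : EuclideanSpace ℝ (Fin n) → ℝ) :
    EuclideanSpace ℝ (Fin n) → ℝ :=
  fun x => ∑ i : Fin n,
    iteratedFDeriv ℝ 2 u x ![EuclideanSpace.single i 1, EuclideanSpace.single i 1]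

/-- The biharmonic operator `Δ²u = Δ(Δu)`. -/
noncomputable def bilap {n : ℕ} (u : EuclideanSpace ℝ (Fin n) → ℝ) :
    EuclideanSpace ℝ (Fin n) → ℝ :=
  lap (lap u)

/-! ### The Laplacian: regularity, invariance, Green's formula, radial functions -/

section Laplacian

variable {n : ℕ}

lemma lap_apply (u : EuclideanSpace ℝ (Fin n) → ℝ) (x : EuclideanSpace ℝ (Fin n)) :
    lap u x = ∑ i : Fin n, fderiv ℝ (fderiv ℝ u) x (EuclideanSpace.single i 1)
      (EuclideanSpace.single i 1) := by
  simp [lap, iteratedFDeriv_two_apply]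

lemma lap_apply_of_contDiff {u : EuclideanSpace ℝ (Fin n) → ℝ} (hu : ContDiff ℝ 2 u)
    (x : EuclideanSpace ℝ (Fin n)) :
    lap u x = ∑ i : Fin n, fderiv ℝ (fun y => fderiv ℝ u y (EuclideanSpace.single i 1)) x
      (EuclideanSpace.single i 1) := by
  rw [lap_apply]
  refine Finset.sum_congr rfl fun i _ => ?_
  have h : DifferentiableAt ℝ (fderiv ℝ u) x :=
    (hu.fderiv_right (m := 1) (by norm_num)).differentiable (by norm_num) x
  rw [fderiv_clm_apply h (by fun_prop)]
  simp

lemma contDiff_lap {u : EuclideanSpace ℝ (Fin n) → ℝ} {m : ℕ} (hu : ContDiff ℝ (m + 2 : ℕ) u) :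
    ContDiff ℝ m (lap u) := by
  unfold lap
  refine ContDiff.sum fun i _ => ?_
  have h : ContDiff ℝ m (iteratedFDeriv ℝ 2 u) :=
    hu.iteratedFDeriv_right (by push_cast; exact le_rfl)
  exact (ContinuousMultilinearMap.apply ℝ (fun _ : Fin 2 => EuclideanSpace ℝ (Fin n)) ℝ
    _).contDiff.comp h

lemma continuous_bilap {u : EuclideanSpace ℝ (Fin n) → ℝ} (hu : ContDiff ℝ 4 u) :
    Continuous (bilap u) :=
  (contDiff_lap (m := 0) (contDiff_lap (m := 2) (by exact_mod_cast hu))).continuous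

lemma hasCompactSupport_lap {u : EuclideanSpace ℝ (Fin n) → ℝ} (hu : HasCompactSupport u) :
    HasCompactSupport (lap u) := by
  refine (hu.iteratedFDeriv (𝕜 := ℝ) 2).mono fun x hx => ?_
  contrapose! hx
  simp only [Function.mem_support, not_not] at hx ⊢
  simp [lap, hx]

lemma lap_const_mul_comp_affine {u : EuclideanSpace ℝ (Fin n) → ℝ} (hu : ContDiff ℝ 2 u)
    (A R : ℝ) (x₀ x : EuclideanSpace ℝ (Fin n)) :
    lap (fun y => A * u (R • y + x₀)) x = A * R ^ 2 * lap u (R • x + x₀) := by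
  have key : ∀ {F : Type} [NormedAddCommGroup F] [NormedSpace ℝ F]
      (f : EuclideanSpace ℝ (Fin n) → F), Differentiable ℝ f → ∀ x,
      HasFDerivAt (fun y => f (R • y + x₀)) (R • fderiv ℝ f (R • x + x₀)) x := by
    intro F _ _ f hf x
    have h1 : HasFDerivAt (fun y : EuclideanSpace ℝ (Fin n) => R • y + x₀)
        (R • ContinuousLinearMap.id ℝ _) x := ((hasFDerivAt_id x).const_smul R).add_const x₀
    have := (hf (R • x + x₀)).hasFDerivAt.comp x h1
    have e : fderiv ℝ f (R • x + x₀) ∘L (R • ContinuousLinearMap.id ℝ _) =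
        R • fderiv ℝ f (R • x + x₀) := by
      ext v; simp
    rwa [e] at this
  have hu1 : Differentiable ℝ u := hu.differentiable (by norm_num)
  have hu2 : Differentiable ℝ (fderiv ℝ u) :=
    (hu.fderiv_right (m := 1) (by norm_num)).differentiable (by norm_num)
  rw [lap_apply, lap_apply, Finset.mul_sum]
  refine Finset.sum_congr rfl fun i _ => ?_
  have e1 : fderiv ℝ (fun y => A * u (R • y + x₀)) =
      fun y => (A * R) • fderiv ℝ u (R • y + x₀) := by
    ext1 y
    rw [((key u hu1 y).const_mul A).fderiv, smul_smul]
  have e2 : HasFDerivAt (fun y => (A * R) • fderiv ℝ u (R • y + x₀)) _ x :=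
    (key _ hu2 x).const_smul (A * R)
  rw [e1, e2.fderiv]
  simp
  ring

lemma bilap_const_mul_comp_affine {u : EuclideanSpace ℝ (Fin n) → ℝ} (hu : ContDiff ℝ 4 u)
    (A R : ℝ) (x₀ x : EuclideanSpace ℝ (Fin n)) :
    bilap (fun y => A * u (R • y + x₀)) x = A * R ^ 4 * bilap u (R • x + x₀) := by
  have h2 : lap (fun y => A * u (R • y + x₀)) = fun y => (A * R ^ 2) * lap u (R • y + x₀) := by
    ext1 y
    exact lap_const_mul_comp_affine (hu.of_le (by norm_num)) A R x₀ y
  rw [bilap, h2, lap_const_mul_comp_affine (contDiff_lap (m := 2) (by exact_mod_cast hu)), bilap]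
  ring

lemma integral_mul_lap {f g : EuclideanSpace ℝ (Fin n) → ℝ} (hf : ContDiff ℝ 2 f)
    (hg : ContDiff ℝ 2 g) (hc : HasCompactSupport g) :
    ∫ x, f x * lap g x = ∫ x, lap f x * g x := by
  have d1 : ∀ {w : EuclideanSpace ℝ (Fin n) → ℝ}, ContDiff ℝ 2 w → ∀ v,
      ContDiff ℝ 1 (fun x => fderiv ℝ w x v) := fun hw v =>
    (hw.fderiv_right (m := 1) (by norm_num)).clm_apply contDiff_const
  have d2 : ∀ {w : EuclideanSpace ℝ (Fin n) → ℝ}, ContDiff ℝ 1 w → ∀ v,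
      Continuous (fun x => fderiv ℝ w x v) := fun hw v =>
    (hw.continuous_fderiv (by norm_num)).clm_apply continuous_const
  have hfc := hf.continuous
  have hgc := hg.continuous
  have c1 : ∀ v, HasCompactSupport (fun x => fderiv ℝ g x v) := fun v =>
    hc.fderiv_apply ℝ v
  have c2 : ∀ v, HasCompactSupport (fun x => fderiv ℝ (fun y => fderiv ℝ g y v) x v) := fun v =>
    (c1 v).fderiv_apply ℝ v
  have int : ∀ {a b : EuclideanSpace ℝ (Fin n) → ℝ}, Continuous a → Continuous b →
      HasCompactSupport b → Integrable (fun x => a x * b x) := fun ha hb hs =>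
    (ha.mul hb).integrable_of_hasCompactSupport hs.mul_left
  have key : ∀ v, ∫ x, f x * fderiv ℝ (fun y => fderiv ℝ g y v) x v =
      ∫ x, fderiv ℝ (fun y => fderiv ℝ f y v) x v * g x := by
    intro v
    rw [integral_mul_fderiv_eq_neg_fderiv_mul_of_integrable
        (int (d1 hf v).continuous (d1 hg v).continuous (c1 v))
        (int hfc (d2 (d1 hg v) v) (c2 v)) (int hfc (d1 hg v).continuous (c1 v))
        (fun x _ => hf.differentiable (by norm_num) x)
        (fun x _ => (d1 hg v).differentiable (by norm_num) x),
      integral_mul_fderiv_eq_neg_fderiv_mul_of_integrable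
        (int (d2 (d1 hf v) v) hgc hc)
        (int (d1 hf v).continuous (d1 hg v).continuous (c1 v))
        (int (d1 hf v).continuous hgc hc)
        (fun x _ => (d1 hf v).differentiable (by norm_num) x)
        (fun x _ => hg.differentiable (by norm_num) x), neg_neg]
  simp_rw [lap_apply_of_contDiff hf, lap_apply_of_contDiff hg, Finset.mul_sum, Finset.sum_mul]
  rw [integral_finsetSum _ fun i _ => int hfc (d2 (d1 hg _) _) (c2 _),
    integral_finsetSum _ fun i _ => int (d2 (d1 hf _) _) hgc hc]
  exact Finset.sum_congr rfl fun i _ => key _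

lemma integral_mul_bilap {f g : EuclideanSpace ℝ (Fin n) → ℝ} (hf : ContDiff ℝ 4 f)
    (hg : ContDiff ℝ 4 g) (hc : HasCompactSupport g) :
    ∫ x, f x * bilap g x = ∫ x, bilap f x * g x := by
  have h2 : ∀ {w : EuclideanSpace ℝ (Fin n) → ℝ}, ContDiff ℝ 4 w → ContDiff ℝ 2 (lap w) :=
    fun hw => contDiff_lap (m := 2) (by exact_mod_cast hw)
  rw [bilap, integral_mul_lap (hf.of_le (by norm_num)) (h2 hg) (hasCompactSupport_lap hc),
    integral_mul_lap (h2 hf) (hg.of_le (by norm_num)) hc, bilap]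

lemma lap_radial {h h₁ h₂ : ℝ → ℝ} (d₁ : ∀ t, 0 ≤ t → HasDerivAt h (h₁ t) t)
    (d₂ : ∀ t, 0 ≤ t → HasDerivAt h₁ (h₂ t) t) (x : EuclideanSpace ℝ (Fin n)) :
    lap (fun y => h (‖y‖ ^ 2)) x = 2 * n * h₁ (‖x‖ ^ 2) + 4 * ‖x‖ ^ 2 * h₂ (‖x‖ ^ 2) := by
  have hsq : ∀ y : EuclideanSpace ℝ (Fin n),
      HasFDerivAt (fun y : EuclideanSpace ℝ (Fin n) => ‖y‖ ^ 2) (2 • innerSL ℝ y) y :=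
    fun y => (hasStrictFDerivAt_norm_sq y).hasFDerivAt
  have e1 : fderiv ℝ (fun y : EuclideanSpace ℝ (Fin n) => h (‖y‖ ^ 2)) =
      fun y => h₁ (‖y‖ ^ 2) • ((2 : ℕ) • innerSL ℝ y) := by
    ext1 y
    exact ((d₁ _ (sq_nonneg _)).comp_hasFDerivAt y (hsq y)).fderiv
  have e2 : HasFDerivAt (fun y : EuclideanSpace ℝ (Fin n) => h₁ (‖y‖ ^ 2)) _ x :=
    (d₂ _ (sq_nonneg _)).comp_hasFDerivAt x (hsq x)
  have e3 : HasFDerivAt (fun y : EuclideanSpace ℝ (Fin n) => (2 : ℕ) • innerSL ℝ y)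
      ((2 : ℕ) • innerSL ℝ (E := EuclideanSpace ℝ (Fin n))) x :=
    ((innerSL ℝ (E := EuclideanSpace ℝ (Fin n))).hasFDerivAt).const_smul (2 : ℕ)
  have e4 : HasFDerivAt (fun y : EuclideanSpace ℝ (Fin n) =>
      h₁ (‖y‖ ^ 2) • ((2 : ℕ) • innerSL ℝ y)) _ x := e2.smul e3
  rw [lap_apply, e1, e4.fderiv]
  have hx : ∑ i, x i ^ 2 = ‖x‖ ^ 2 := by
    rw [EuclideanSpace.norm_sq_eq]; simp
  have h1 : ∀ i : Fin n, innerSL ℝ (EuclideanSpace.single i (1 : ℝ))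
      (EuclideanSpace.single i (1 : ℝ)) = 1 := fun i => by
    rw [innerSL_apply_apply, EuclideanSpace.inner_single_right]; simp
  have h2 : ∀ i : Fin n, innerSL ℝ x (EuclideanSpace.single i (1 : ℝ)) = x i := fun i => by
    rw [innerSL_apply_apply, EuclideanSpace.inner_single_right]; simp
  calc _ = ∑ i : Fin n, (2 * h₁ (‖x‖ ^ 2) + 4 * h₂ (‖x‖ ^ 2) * x i ^ 2) := by
        refine Finset.sum_congr rfl fun i _ => ?_
        simp only [add_apply, smul_apply,
          ContinuousLinearMap.smulRight_apply, h1, h2, smul_eq_mul, nsmul_eq_mul]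
        push_cast
        ring
    _ = _ := by
        rw [Finset.sum_add_distrib, ← Finset.mul_sum Finset.univ (fun i => x i ^ 2), hx]
        simp
        ring

lemma bilap_radial {h h₁ h₂ h₃ h₄ : ℝ → ℝ} (d₁ : ∀ t, 0 ≤ t → HasDerivAt h (h₁ t) t)
    (d₂ : ∀ t, 0 ≤ t → HasDerivAt h₁ (h₂ t) t) (d₃ : ∀ t, 0 ≤ t → HasDerivAt h₂ (h₃ t) t)
    (d₄ : ∀ t, 0 ≤ t → HasDerivAt h₃ (h₄ t) t) (x : EuclideanSpace ℝ (Fin n)) :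
    bilap (fun y => h (‖y‖ ^ 2)) x = 4 * n * (n + 2) * h₂ (‖x‖ ^ 2)
      + (16 * n + 32) * ‖x‖ ^ 2 * h₃ (‖x‖ ^ 2) + 16 * (‖x‖ ^ 2) ^ 2 * h₄ (‖x‖ ^ 2) := by
  have e : lap (fun y : EuclideanSpace ℝ (Fin n) => h (‖y‖ ^ 2)) =
      fun y => (fun t => 2 * n * h₁ t + 4 * t * h₂ t) (‖y‖ ^ 2) := by
    ext1 y; exact lap_radial d₁ d₂ y
  have f₁ : ∀ t, 0 ≤ t → HasDerivAt (fun t => 2 * n * h₁ t + 4 * t * h₂ t)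
      ((2 * n + 4) * h₂ t + 4 * t * h₃ t) t := by
    intro t ht
    refine (((d₂ t ht).const_mul (2 * n : ℝ)).add
      (((hasDerivAt_id' t).const_mul 4).mul (d₃ t ht))).congr_deriv ?_
    ring
  have f₂ : ∀ t, 0 ≤ t → HasDerivAt (fun t => (2 * n + 4) * h₂ t + 4 * t * h₃ t)
      ((2 * n + 8) * h₃ t + 4 * t * h₄ t) t := by
    intro t ht
    refine (((d₃ t ht).const_mul (2 * n + 4 : ℝ)).add
      (((hasDerivAt_id' t).const_mul 4).mul (d₄ t ht))).congr_deriv ?_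
    ring
  rw [bilap, e, lap_radial f₁ f₂]
  ring

end Laplacian

/-! ### The a priori integral bound -/

section APriori

lemma hasDerivAt_max_zero_pow (m : ℕ) (t : ℝ) :
    HasDerivAt (fun t : ℝ => max 0 t ^ (m + 2)) ((m + 2) * max 0 t ^ (m + 1)) t := by
  rcases lt_trichotomy t 0 with ht | rfl | ht
  · have : (fun t : ℝ => max 0 t ^ (m + 2)) =ᶠ[nhds t] fun _ => 0 := by
      filter_upwards [Iio_mem_nhds ht] with s hs
      rw [max_eq_left (le_of_lt hs)]; simp
    rw [max_eq_left ht.le]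
    simpa using (hasDerivAt_const t (0 : ℝ)).congr_of_eventuallyEq this
  · have hl : HasDerivWithinAt (fun t : ℝ => max 0 t ^ (m + 2)) 0 (Set.Iic 0) 0 := by
      refine (hasDerivWithinAt_const (0 : ℝ) (Set.Iic 0) (0 : ℝ)).congr (fun s hs => ?_) (by simp)
      rw [max_eq_left hs]; simp
    have hr : HasDerivWithinAt (fun t : ℝ => max 0 t ^ (m + 2)) 0 (Set.Ici 0) 0 := by
      have := (hasDerivAt_pow (m + 2) (0 : ℝ)).hasDerivWithinAt (s := Set.Ici 0)
      simp only [Nat.add_one_sub_one, ne_eq, Nat.add_eq_zero_iff, one_ne_zero, and_false,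
        not_false_eq_true, zero_pow, mul_zero] at this
      refine this.congr (fun s hs => ?_) (by simp)
      rw [max_eq_right hs]
    have := hl.union hr
    rw [Set.Iic_union_Ici, hasDerivWithinAt_univ] at this
    simpa using this
  · have : (fun t : ℝ => max 0 t ^ (m + 2)) =ᶠ[nhds t] fun t => t ^ (m + 2) := by
      filter_upwards [Ioi_mem_nhds ht] with s hs
      rw [max_eq_right (le_of_lt hs)]
    rw [max_eq_right ht.le]
    refine ((hasDerivAt_pow (m + 2) t).congr_of_eventuallyEq this).congr_deriv ?_
    push_cast
    rfl

lemma contDiff_max_zero_pow (j m : ℕ) : ContDiff ℝ j (fun t : ℝ => max 0 t ^ (m + j + 1)) := by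
  induction j with
  | zero => exact contDiff_zero.2 (by fun_prop)
  | succ j ih =>
    push_cast
    rw [contDiff_succ_iff_deriv]
    have hd := fun t => hasDerivAt_max_zero_pow (m + j) t
    refine ⟨fun t => (hd t).differentiableAt, by simp, ?_⟩
    have : deriv (fun t : ℝ => max 0 t ^ (m + (j + 1) + 1)) =
        fun t => ((m + j : ℕ) + 2 : ℝ) * max 0 t ^ (m + j + 1) := funext fun t => (hd t).deriv
    rw [this]
    exact contDiff_const.mul ih

lemma hasDerivAt_const_mul_max_zero_one_sub_pow (c : ℝ) (m : ℕ) (t : ℝ) :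
    HasDerivAt (fun t : ℝ => c * max 0 (1 - t) ^ (m + 2))
      (-(c * (m + 2)) * max 0 (1 - t) ^ (m + 1)) t := by
  have h := (hasDerivAt_max_zero_pow m (1 - t)).comp t ((hasDerivAt_id' t).const_sub 1)
  refine (h.const_mul c).congr_deriv ?_
  ring

lemma mul_le_half_rpow_add {A p : ℝ} (hA : 0 ≤ A) (hp : 1 < p) {s : ℝ} (hs : 0 ≤ s) :
    A * s ≤ 1 / 2 * s ^ p + A * (2 * A) ^ (1 / (p - 1)) := by
  have hp' : 0 < p - 1 := by linarith
  rcases le_total s ((2 * A) ^ (1 / (p - 1))) with h | h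
  · have := mul_le_mul_of_nonneg_left h hA
    have := Real.rpow_nonneg hs p
    linarith
  · have h1 : 2 * A ≤ s ^ (p - 1) := by
      have := Real.rpow_le_rpow (by positivity) h hp'.le
      rwa [← Real.rpow_mul (by positivity), one_div_mul_cancel hp'.ne', Real.rpow_one] at this
    have h2 : s ^ p = s * s ^ (p - 1) := by
      rcases hs.eq_or_lt with rfl | hs'
      · rw [Real.zero_rpow (by linarith)]; simp
      · rw [← Real.rpow_one_add' hs (by linarith)]; congr 1; ring
    have h3 : 0 ≤ A * (2 * A) ^ (1 / (p - 1)) := by positivity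
    rw [h2]
    nlinarith

lemma exists_abs_bilap_max_zero_pow_le (n N : ℕ) : ∃ A : ℝ, 0 ≤ A ∧
    ∀ x : EuclideanSpace ℝ (Fin n),
      |bilap (fun y : EuclideanSpace ℝ (Fin n) => max 0 (1 - ‖y‖ ^ 2) ^ (N + 6)) x| ≤
        A * max 0 (1 - ‖x‖ ^ 2) ^ (N + 2) := by
  have d₁ := fun t => hasDerivAt_const_mul_max_zero_one_sub_pow 1 (N + 4) t
  have d₂ := fun t => hasDerivAt_const_mul_max_zero_one_sub_pow
    (-(1 * ((N + 4 : ℕ) + 2 : ℝ))) (N + 3) t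
  have d₃ := fun t => hasDerivAt_const_mul_max_zero_one_sub_pow
    (-(-(1 * ((N + 4 : ℕ) + 2 : ℝ)) * ((N + 3 : ℕ) + 2 : ℝ))) (N + 2) t
  have d₄ := fun t => hasDerivAt_const_mul_max_zero_one_sub_pow
    (-(-(-(1 * ((N + 4 : ℕ) + 2 : ℝ)) * ((N + 3 : ℕ) + 2 : ℝ)) * ((N + 2 : ℕ) + 2 : ℝ))) (N + 1) t
  have key := bilap_radial (n := n) (fun t _ => d₁ t) (fun t _ => d₂ t) (fun t _ => d₃ t)
    (fun t _ => d₄ t)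
  simp only [one_mul] at key
  generalize ha : -(-((N + 4 : ℕ) + 2 : ℝ) * ((N + 3 : ℕ) + 2 : ℝ)) = a at key
  generalize hb : -(a * ((N + 2 : ℕ) + 2 : ℝ)) = b at key
  generalize hc : -(b * ((N + 1 : ℕ) + 2 : ℝ)) = c at key
  refine ⟨4 * n * (n + 2) * |a| + (16 * n + 32) * |b| + 16 * |c|, by positivity, fun x => ?_⟩
  rw [key]
  generalize hT : ‖x‖ ^ 2 = T
  have hT0 : 0 ≤ T := hT ▸ sq_nonneg _
  rcases le_total 1 T with h | h
  · rw [max_eq_left (by linarith)]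
    simp
  · rw [max_eq_right (by linarith)]
    have hy0 : 0 ≤ 1 - T := by linarith
    have hy1 : 1 - T ≤ 1 := by linarith
    set Y := (1 - T) ^ (N + 2) with hY
    have hY0 : 0 ≤ Y := by positivity
    have e3 : (1 - T) ^ (N + 3) ≤ Y := pow_le_pow_of_le_one hy0 hy1 (by omega)
    have e4 : (1 - T) ^ (N + 4) ≤ Y := pow_le_pow_of_le_one hy0 hy1 (by omega)
    have hTT : T ^ 2 ≤ 1 := pow_le_one₀ hT0 h
    calc _ ≤ |4 * n * (n + 2) * (a * (1 - T) ^ (N + 4))| +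
          |(16 * n + 32) * T * (b * (1 - T) ^ (N + 3))| + |16 * T ^ 2 * (c * (1 - T) ^ (N + 2))| :=
          (abs_add_le _ _).trans (by gcongr; exact abs_add_le _ _)
      _ = 4 * n * (n + 2) * (|a| * (1 - T) ^ (N + 4)) +
          (16 * n + 32) * T * (|b| * (1 - T) ^ (N + 3)) + 16 * T ^ 2 * (|c| * Y) := by
          have h1 : |(4 * n * (n + 2) : ℝ)| = 4 * n * (n + 2) := abs_of_nonneg (by positivity)
          have h2 : |(16 * n + 32 : ℝ)| = 16 * n + 32 := abs_of_nonneg (by positivity)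
          rw [abs_mul _ (a * _), abs_mul _ (b * _), abs_mul _ (c * _), abs_mul a, abs_mul b,
            abs_mul c, abs_mul _ T, abs_mul _ (T ^ 2), h1, h2]
          simp only [abs_pow, abs_of_nonneg hy0, abs_of_nonneg hT0, hY, Nat.abs_ofNat]
      _ ≤ 4 * n * (n + 2) * (|a| * Y) + (16 * n + 32) * 1 * (|b| * Y) + 16 * 1 * (|c| * Y) := by
          gcongr
      _ = _ := by ring

lemma exists_integral_ball_le (n : ℕ) {p : ℝ} (hp : 1 < p) : ∃ C : ℝ, 0 ≤ C ∧
    ∀ u : EuclideanSpace ℝ (Fin n) → ℝ, ContDiff ℝ 4 u → (∀ x, 0 ≤ u x) →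
      (∀ x, bilap u x = u x ^ p) → ∫ x in ball 0 (1 / 2), u x ≤ C := by
  obtain ⟨N, hN⟩ := exists_nat_ge (4 * p / (p - 1))
  obtain ⟨A, hA, hbd⟩ := exists_abs_bilap_max_zero_pow_le n N
  set K := A * (2 * A) ^ (1 / (p - 1)) with hK
  have hK0 : 0 ≤ K := by positivity
  set V := volume.real (ball (0 : EuclideanSpace ℝ (Fin n)) 1)
  set V' := volume.real (ball (0 : EuclideanSpace ℝ (Fin n)) (1 / 2))
  refine ⟨V' + (4 / 3) ^ (N + 6) * (2 * (K * V)), by positivity, fun u hu hpos heq => ?_⟩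
  set ψ : EuclideanSpace ℝ (Fin n) → ℝ := fun y => max 0 (1 - ‖y‖ ^ 2) ^ (N + 6) with hψ
  have hψc : ContDiff ℝ 4 ψ := by
    have := contDiff_max_zero_pow 4 (N + 1)
    exact (show ContDiff ℝ 4 (fun t : ℝ => max 0 t ^ (N + 6)) by exact_mod_cast this).comp
      (contDiff_const.sub (contDiff_norm_sq ℝ))
  have hout : ∀ x : EuclideanSpace ℝ (Fin n), x ∉ ball (0 : EuclideanSpace ℝ (Fin n)) 1 →
      max 0 (1 - ‖x‖ ^ 2) = 0 := fun x hx => by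
    rw [mem_ball_zero_iff, not_lt] at hx
    exact max_eq_left (by nlinarith)
  have hψs : HasCompactSupport ψ := by
    refine HasCompactSupport.of_support_subset_isCompact (isCompact_closedBall 0 1) fun x hx => ?_
    by_contra h
    exact hx (by simp [hψ, hout x (fun h' => h (ball_subset_closedBall h'))])
  have hψ0 : ∀ x, 0 ≤ ψ x := fun x => by positivity
  have hupc : Continuous fun x => u x ^ p :=
    hu.continuous.rpow_const fun _ => Or.inr (by linarith)
  have i1 : Integrable fun x => u x ^ p * ψ x :=
    (hupc.mul hψc.continuous).integrable_of_hasCompactSupport hψs.mul_left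
  have i2 : Integrable fun x => u x * bilap ψ x :=
    (hu.continuous.mul (continuous_bilap hψc)).integrable_of_hasCompactSupport
      (hasCompactSupport_lap (hasCompactSupport_lap hψs)).mul_left
  have i3 : Integrable ((ball (0 : EuclideanSpace ℝ (Fin n)) 1).indicator fun _ => K) :=
    (integrable_indicator_iff measurableSet_ball).2 (integrableOn_const measure_ball_lt_top.ne)
  have pt : ∀ x, u x * bilap ψ x ≤ 1 / 2 * (u x ^ p * ψ x) +
      (ball (0 : EuclideanSpace ℝ (Fin n)) 1).indicator (fun _ => K) x := by
    intro x
    have hb := (le_abs_self _).trans (hbd x)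
    by_cases hx : x ∈ ball (0 : EuclideanSpace ℝ (Fin n)) 1
    · rw [Set.indicator_of_mem hx]
      rw [mem_ball_zero_iff] at hx
      have hy : 0 < 1 - ‖x‖ ^ 2 := by nlinarith [norm_nonneg x]
      rw [max_eq_right hy.le] at hb
      simp only [hψ]
      rw [max_eq_right hy.le]
      set y := 1 - ‖x‖ ^ 2
      have hy1 : y ≤ 1 := sub_le_self _ (sq_nonneg _)
      have hs := mul_le_half_rpow_add hA hp
        (mul_nonneg (hpos x) (Real.rpow_nonneg hy.le (((N + 6 : ℕ) : ℝ) / p)))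
      rw [Real.mul_rpow (hpos x) (by positivity), ← Real.rpow_mul hy.le,
        div_mul_cancel₀ _ (by linarith), Real.rpow_natCast] at hs
      have he : y ^ (N + 2) ≤ y ^ (((N + 6 : ℕ) : ℝ) / p) := by
        rw [← Real.rpow_natCast]
        refine Real.rpow_le_rpow_of_exponent_ge hy hy1 ?_
        rw [div_le_iff₀ (by linarith)]
        rw [div_le_iff₀ (by linarith)] at hN
        push_cast
        nlinarith
      calc u x * bilap ψ x ≤ u x * (A * y ^ (N + 2)) := mul_le_mul_of_nonneg_left hb (hpos x)
        _ ≤ u x * (A * y ^ (((N + 6 : ℕ) : ℝ) / p)) := by have := hpos x; gcongr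
        _ = A * (u x * y ^ (((N + 6 : ℕ) : ℝ) / p)) := by ring
        _ ≤ _ := hs
    · rw [Set.indicator_of_notMem hx]
      rw [hout x hx] at hb
      simp only [ne_eq, Nat.add_eq_zero_iff, OfNat.ofNat_ne_zero, and_false, not_false_eq_true,
        zero_pow, mul_zero] at hb
      have h1 := mul_le_mul_of_nonneg_left hb (hpos x)
      have h2 := mul_nonneg (Real.rpow_nonneg (hpos x) p) (hψ0 x)
      linarith
  have hI : ∫ x, u x ^ p * ψ x ≤ 2 * (K * V) := by
    have h1 : ∫ x, u x ^ p * ψ x = ∫ x, u x * bilap ψ x := by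
      rw [integral_mul_bilap hu hψc hψs]
      simp_rw [heq]
    have h2 : ∫ x, u x * bilap ψ x ≤ 1 / 2 * (∫ x, u x ^ p * ψ x) + K * V := by
      refine (integral_mono i2 ((i1.const_mul _).add i3) pt).trans_eq ?_
      simp only [Pi.add_apply]
      rw [integral_add (i1.const_mul _) i3, integral_const_mul,
        integral_indicator measurableSet_ball, setIntegral_const, smul_eq_mul, mul_comm K]
    linarith
  have hfin : IntegrableOn (fun _ : EuclideanSpace ℝ (Fin n) => (1 : ℝ))
      (ball (0 : EuclideanSpace ℝ (Fin n)) (1 / 2)) :=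
    integrableOn_const measure_ball_lt_top.ne
  calc ∫ x in ball 0 (1 / 2), u x
      ≤ ∫ x in ball 0 (1 / 2), (1 + (4 / 3) ^ (N + 6) * (u x ^ p * ψ x)) := by
        refine setIntegral_mono_on ?_ (hfin.add (i1.integrableOn.const_mul _)) measurableSet_ball
          fun x hx => ?_
        · exact (hu.continuous.continuousOn.integrableOn_compact
            (isCompact_closedBall 0 (1 / 2))).mono_set ball_subset_closedBall
        · rw [mem_ball_zero_iff] at hx
          have hy : 3 / 4 ≤ max 0 (1 - ‖x‖ ^ 2) := by
            refine le_max_of_le_right ?_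
            nlinarith [norm_nonneg x]
          have h1 : 1 ≤ (4 / 3 : ℝ) ^ (N + 6) * ψ x := by
            simp only [hψ]
            rw [← mul_pow]
            exact one_le_pow₀ (by linarith)
          have h2 : u x ≤ 1 + u x ^ p := by
            rcases le_total (u x) 1 with h | h
            · have := Real.rpow_nonneg (hpos x) p
              linarith
            · have := Real.rpow_le_rpow_of_exponent_le h hp.le
              rw [Real.rpow_one] at this
              linarith
          have h3 := mul_le_mul_of_nonneg_left h1 (Real.rpow_nonneg (hpos x) p)
          linarith
    _ = V' + (4 / 3) ^ (N + 6) * ∫ x in ball 0 (1 / 2), u x ^ p * ψ x := by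
        rw [integral_add hfin (i1.integrableOn.const_mul _), integral_const_mul, setIntegral_const]
        simp [V']
    _ ≤ _ := by
        gcongr
        refine (setIntegral_le_integral i1 (ae_of_all _ fun x => ?_)).trans hI
        exact mul_nonneg (Real.rpow_nonneg (hpos x) p) (hψ0 x)

end APriori

/-! ### The localized representation formula -/

section Representation

/-- A smooth cutoff on the line: equal to `1` for `t ≤ 1/8` and to `0` for `t ≥ 3/16`. -/
noncomputable def cutoff (t : ℝ) : ℝ := Real.smoothTransition (3 - 16 * t)

lemma cutoff_nonneg (t : ℝ) : 0 ≤ cutoff t := Real.smoothTransition.nonneg _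

lemma cutoff_le_one (t : ℝ) : cutoff t ≤ 1 := Real.smoothTransition.le_one _

lemma cutoff_eq_one {t : ℝ} (ht : t ≤ 1 / 8) : cutoff t = 1 :=
  Real.smoothTransition.one_of_one_le (by linarith)

lemma cutoff_eq_zero {t : ℝ} (ht : 3 / 16 ≤ t) : cutoff t = 0 :=
  Real.smoothTransition.zero_of_nonpos (by linarith)

lemma contDiff_cutoff {m : ℕ} : ContDiff ℝ m cutoff :=
  Real.smoothTransition.contDiff.comp (contDiff_const.sub (contDiff_const.mul contDiff_id))

lemma hasDerivAt_iteratedDeriv_cutoff (j : ℕ) (t : ℝ) :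
    HasDerivAt (iteratedDeriv j cutoff) (iteratedDeriv (j + 1) cutoff t) t := by
  rw [iteratedDeriv_succ]
  exact ((contDiff_cutoff (m := j + 1)).differentiable_iteratedDeriv j
    (by exact_mod_cast Nat.lt_succ_self j) t).hasDerivAt

lemma iteratedDeriv_cutoff_eq_zero_of_lt (j : ℕ) {t : ℝ} (ht : t < 1 / 8) :
    iteratedDeriv (j + 1) cutoff t = 0 := by
  have : cutoff =ᶠ[nhds t] fun _ => 1 := by
    filter_upwards [Iio_mem_nhds ht] with s hs using cutoff_eq_one (le_of_lt hs)
  rw [this.iteratedDeriv_eq, iteratedDeriv_const]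
  simp

lemma iteratedDeriv_cutoff_eq_zero_of_ge (j : ℕ) {t : ℝ} (ht : 1 / 4 ≤ t) :
    iteratedDeriv j cutoff t = 0 := by
  have : cutoff =ᶠ[nhds t] fun _ => 0 := by
    filter_upwards [Ioi_mem_nhds (show 3 / 16 < t by linarith)] with s hs
      using cutoff_eq_zero (le_of_lt hs)
  rw [this.iteratedDeriv_eq, iteratedDeriv_const]
  simp

lemma exists_bound_iteratedDeriv_cutoff : ∃ M : ℝ, 0 ≤ M ∧
    ∀ j ≤ 4, ∀ t ∈ Set.Icc (1 / 8 : ℝ) (1 / 4), |iteratedDeriv j cutoff t| ≤ M := by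
  have h : ∀ j : ℕ, ∃ M, ∀ t ∈ Set.Icc (1 / 8 : ℝ) (1 / 4), ‖iteratedDeriv j cutoff t‖ ≤ M :=
    fun j => isCompact_Icc.exists_bound_of_continuousOn
      ((contDiff_cutoff (m := j)).continuous_iteratedDeriv j le_rfl).continuousOn
  choose M hM using h
  refine ⟨∑ j ∈ Finset.range 5, |M j|, by positivity, fun j hj t ht => ?_⟩
  refine ((hM j t ht).trans (le_abs_self _)).trans ?_
  exact Finset.single_le_sum (f := fun j => |M j|) (fun i _ => abs_nonneg _)
    (Finset.mem_range.2 (by omega))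

lemma hasDerivAt_const_mul_add_rpow {e : ℝ} (he : 0 < e) (A b : ℝ) {t : ℝ} (ht : 0 ≤ t) :
    HasDerivAt (fun t => A * (e + t) ^ b) (A * b * (e + t) ^ (b - 1)) t := by
  have h := ((hasDerivAt_id' t).const_add e).rpow_const (p := b) (Or.inl (by linarith : e + t ≠ 0))
  refine (h.const_mul A).congr_deriv ?_
  ring

/-- For radial functions of the form `(e + ‖x‖²) ^ (-a) * cutoff (‖x‖²)` the bilaplacian is a
multiple of an approximate identity up to a remainder which is bounded uniformly in `e`. -/
lemma exists_bilap_regularized_kernel_sub_le (k : ℕ) : ∃ C : ℝ, 0 ≤ C ∧ ∀ e : ℝ, 0 < e →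
    ∀ x : EuclideanSpace ℝ (Fin (k + 4)),
      |bilap (fun y : EuclideanSpace ℝ (Fin (k + 4)) =>
          (e + ‖y‖ ^ 2) ^ (-(k / 2 : ℝ)) * cutoff (‖y‖ ^ 2)) x -
        cutoff (‖x‖ ^ 2) * (k * (k + 2) * (k + 4) * (k + 6) *
          (e ^ 2 * (e + ‖x‖ ^ 2) ^ (-(k / 2 : ℝ) - 4)))| ≤
      (ball (0 : EuclideanSpace ℝ (Fin (k + 4))) (1 / 2)).indicator (fun _ => C) x := by
  obtain ⟨M, hM0, hM⟩ := exists_bound_iteratedDeriv_cutoff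
  set a : ℝ := k / 2 with ha
  have ha0 : 0 ≤ a := by positivity
  set A₁ : ℝ := 1 * (-a) with hA₁
  set A₂ : ℝ := A₁ * (-a - 1) with hA₂
  set A₃ : ℝ := A₂ * (-a - 1 - 1) with hA₃
  set A₄ : ℝ := A₃ * (-a - 1 - 1 - 1) with hA₄
  set B : ℝ := (1 + |A₁| + |A₂| + |A₃|) * 8 ^ (a + 3) with hB
  set n : ℝ := k + 4 with hn
  have hn0 : 0 ≤ n := by positivity
  refine ⟨4 * n * (n + 2) * (3 * (B * M)) + (16 * n + 32) * (7 * (B * M)) + 16 * (15 * (B * M)),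
    by positivity, fun e he x => ?_⟩
  set c := fun j : ℕ => iteratedDeriv j cutoff with hc
  have hc' : ∀ j t, HasDerivAt (c j) (c (j + 1) t) t := hasDerivAt_iteratedDeriv_cutoff
  have g₀ := fun t (ht : 0 ≤ t) => hasDerivAt_const_mul_add_rpow he 1 (-a) ht
  have g₁ := fun t (ht : 0 ≤ t) => hasDerivAt_const_mul_add_rpow he A₁ (-a - 1) ht
  have g₂ := fun t (ht : 0 ≤ t) => hasDerivAt_const_mul_add_rpow he A₂ (-a - 1 - 1) ht
  have g₃ := fun t (ht : 0 ≤ t) => hasDerivAt_const_mul_add_rpow he A₃ (-a - 1 - 1 - 1) ht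
  rw [← hA₁] at g₀
  rw [← hA₂] at g₁
  rw [← hA₃] at g₂
  rw [← hA₄] at g₃
  set G₀ : ℝ → ℝ := fun t => 1 * (e + t) ^ (-a) with hG₀
  set G₁ : ℝ → ℝ := fun t => A₁ * (e + t) ^ (-a - 1) with hG₁
  set G₂ : ℝ → ℝ := fun t => A₂ * (e + t) ^ (-a - 1 - 1) with hG₂
  set G₃ : ℝ → ℝ := fun t => A₃ * (e + t) ^ (-a - 1 - 1 - 1) with hG₃
  set G₄ : ℝ → ℝ := fun t => A₄ * (e + t) ^ (-a - 1 - 1 - 1 - 1) with hG₄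
  have d₁ : ∀ t, 0 ≤ t → HasDerivAt (fun t => G₀ t * c 0 t) (G₁ t * c 0 t + G₀ t * c 1 t) t :=
    fun t ht => (g₀ t ht).mul (hc' 0 t)
  have d₂ : ∀ t, 0 ≤ t → HasDerivAt (fun t => G₁ t * c 0 t + G₀ t * c 1 t)
      (G₂ t * c 0 t + 2 * (G₁ t * c 1 t) + G₀ t * c 2 t) t := fun t ht =>
    (((g₁ t ht).mul (hc' 0 t)).add ((g₀ t ht).mul (hc' 1 t))).congr_deriv (by ring)
  have d₃ : ∀ t, 0 ≤ t → HasDerivAt (fun t => G₂ t * c 0 t + 2 * (G₁ t * c 1 t) + G₀ t * c 2 t)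
      (G₃ t * c 0 t + 3 * (G₂ t * c 1 t) + 3 * (G₁ t * c 2 t) + G₀ t * c 3 t) t := fun t ht =>
    ((((g₂ t ht).mul (hc' 0 t)).add (((g₁ t ht).mul (hc' 1 t)).const_mul 2)).add
      ((g₀ t ht).mul (hc' 2 t))).congr_deriv (by ring)
  have d₄ : ∀ t, 0 ≤ t → HasDerivAt
      (fun t => G₃ t * c 0 t + 3 * (G₂ t * c 1 t) + 3 * (G₁ t * c 2 t) + G₀ t * c 3 t)
      (G₄ t * c 0 t + 4 * (G₃ t * c 1 t) + 6 * (G₂ t * c 2 t) + 4 * (G₁ t * c 3 t) +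
        G₀ t * c 4 t) t := fun t ht =>
    (((((g₃ t ht).mul (hc' 0 t)).add (((g₂ t ht).mul (hc' 1 t)).const_mul 3)).add
      (((g₁ t ht).mul (hc' 2 t)).const_mul 3)).add
      ((g₀ t ht).mul (hc' 3 t))).congr_deriv (by ring)
  have key := bilap_radial (n := k + 4) d₁ d₂ d₃ d₄ x
  have hfun : (fun y : EuclideanSpace ℝ (Fin (k + 4)) =>
      (e + ‖y‖ ^ 2) ^ (-a) * cutoff (‖y‖ ^ 2)) = fun y => G₀ (‖y‖ ^ 2) * c 0 (‖y‖ ^ 2) := by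
    ext y
    simp [hG₀, hc]
  rw [hfun, key]
  have hnn : ((k + 4 : ℕ) : ℝ) = n := by rw [hn]; push_cast; rfl
  rw [hnn]
  have hball : x ∈ ball (0 : EuclideanSpace ℝ (Fin (k + 4))) (1 / 2) ↔ ‖x‖ ^ 2 < 1 / 4 := by
    rw [mem_ball_zero_iff, ← sq_lt_sq₀ (norm_nonneg x) (by norm_num)]
    norm_num
  have hc0 : cutoff (‖x‖ ^ 2) = c 0 (‖x‖ ^ 2) := by simp [hc]
  rw [hc0]
  set t := ‖x‖ ^ 2 with ht
  have ht0 : 0 ≤ t := sq_nonneg _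
  have hs : 0 < e + t := by linarith
  have hbub : 4 * n * (n + 2) * G₂ t + (16 * n + 32) * t * G₃ t + 16 * t ^ 2 * G₄ t =
      k * (k + 2) * (k + 4) * (k + 6) * (e ^ 2 * (e + t) ^ (-a - 4)) := by
    set Z := (e + t) ^ (-a - 4) with hZ
    have e4 : (e + t) ^ (-a - 1 - 1 - 1 - 1) = Z := by rw [hZ]; congr 1; ring
    have e3 : (e + t) ^ (-a - 1 - 1 - 1) = (e + t) * Z := by
      rw [hZ, ← Real.rpow_one_add' hs.le (by linarith)]; congr 1; ring
    have e2 : (e + t) ^ (-a - 1 - 1) = (e + t) * ((e + t) * Z) := by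
      rw [← e3, ← Real.rpow_one_add' hs.le (by linarith)]; congr 1; ring
    have hk : (k : ℝ) = 2 * a := by rw [ha]; ring
    simp only [hG₂, hG₃, hG₄, e2, e3, e4, hn, hA₄, hA₃, hA₂, hA₁, hk]
    ring
  rw [← hbub]
  have hrem : 4 * n * (n + 2) * (G₂ t * c 0 t + 2 * (G₁ t * c 1 t) + G₀ t * c 2 t) +
      (16 * n + 32) * t *
        (G₃ t * c 0 t + 3 * (G₂ t * c 1 t) + 3 * (G₁ t * c 2 t) + G₀ t * c 3 t) +
      16 * t ^ 2 * (G₄ t * c 0 t + 4 * (G₃ t * c 1 t) + 6 * (G₂ t * c 2 t) +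
        4 * (G₁ t * c 3 t) + G₀ t * c 4 t) -
      c 0 t * (4 * n * (n + 2) * G₂ t + (16 * n + 32) * t * G₃ t + 16 * t ^ 2 * G₄ t) =
      4 * n * (n + 2) * (2 * (G₁ t * c 1 t) + G₀ t * c 2 t) +
      (16 * n + 32) * (t * (3 * (G₂ t * c 1 t) + 3 * (G₁ t * c 2 t) + G₀ t * c 3 t)) +
      16 * (t ^ 2 * (4 * (G₃ t * c 1 t) + 6 * (G₂ t * c 2 t) + 4 * (G₁ t * c 3 t) +
        G₀ t * c 4 t)) := by ring
  rw [hrem]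
  rcases lt_or_ge t (1 / 8) with h8 | h8
  · have hz : ∀ j, c (j + 1) t = 0 := fun j => iteratedDeriv_cutoff_eq_zero_of_lt j h8
    rw [hz 0, hz 1, hz 2, hz 3, Set.indicator_of_mem (hball.2 (by linarith))]
    simp only [mul_zero, add_zero, abs_zero]
    positivity
  rcases lt_or_ge t (1 / 4) with h4 | h4
  swap
  · have hz : ∀ j, c j t = 0 := fun j => iteratedDeriv_cutoff_eq_zero_of_ge j h4
    rw [hz 1, hz 2, hz 3, hz 4, Set.indicator_of_notMem (fun h => by linarith [hball.1 h])]
    simp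
  rw [Set.indicator_of_mem (hball.2 h4)]
  have hcM : ∀ j ≤ 4, |c j t| ≤ M := fun j hj => hM j hj t ⟨h8, h4.le⟩
  have hG : ∀ D b : ℝ, |D| ≤ 1 + |A₁| + |A₂| + |A₃| → b ≤ 0 → -(a + 3) ≤ b →
      |D * (e + t) ^ b| ≤ B := by
    intro D b hD hb hb'
    rw [abs_mul, abs_of_nonneg (Real.rpow_nonneg hs.le b), hB]
    gcongr
    calc (e + t) ^ b ≤ (1 / 8) ^ b :=
          Real.rpow_le_rpow_of_nonpos (by norm_num) (by linarith) hb
      _ = 8 ^ (-b) := by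
          rw [one_div, Real.inv_rpow (by norm_num), Real.rpow_neg (by norm_num)]
      _ ≤ 8 ^ (a + 3) := Real.rpow_le_rpow_of_exponent_le (by norm_num) (by linarith)
  have p1 := abs_nonneg A₁
  have p2 := abs_nonneg A₂
  have p3 := abs_nonneg A₃
  have b0 : |G₀ t| ≤ B := hG 1 (-a) (by rw [abs_one]; linarith) (by linarith) (by linarith)
  have b1 : |G₁ t| ≤ B := hG A₁ _ (by linarith) (by linarith) (by linarith)
  have b2 : |G₂ t| ≤ B := hG A₂ _ (by linarith) (by linarith) (by linarith)
  have b3 : |G₃ t| ≤ B := hG A₃ _ (by linarith) (by linarith) (by linarith)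
  have hB0 : 0 ≤ B := (abs_nonneg _).trans b0
  have prod : ∀ {r s : ℝ}, |r| ≤ B → |s| ≤ M → |r * s| ≤ B * M := fun hr hs' => by
    rw [abs_mul]; gcongr
  have q11 := abs_le.1 (prod b1 (hcM 1 (by norm_num)))
  have q02 := abs_le.1 (prod b0 (hcM 2 (by norm_num)))
  have q21 := abs_le.1 (prod b2 (hcM 1 (by norm_num)))
  have q12 := abs_le.1 (prod b1 (hcM 2 (by norm_num)))
  have q03 := abs_le.1 (prod b0 (hcM 3 (by norm_num)))
  have q31 := abs_le.1 (prod b3 (hcM 1 (by norm_num)))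
  have q22 := abs_le.1 (prod b2 (hcM 2 (by norm_num)))
  have q13 := abs_le.1 (prod b1 (hcM 3 (by norm_num)))
  have q04 := abs_le.1 (prod b0 (hcM 4 (by norm_num)))
  have r1 : |2 * (G₁ t * c 1 t) + G₀ t * c 2 t| ≤ 3 * (B * M) :=
    abs_le.2 ⟨by linarith [q11.1, q02.1], by linarith [q11.2, q02.2]⟩
  have r2 : |3 * (G₂ t * c 1 t) + 3 * (G₁ t * c 2 t) + G₀ t * c 3 t| ≤ 7 * (B * M) :=
    abs_le.2 ⟨by linarith [q21.1, q12.1, q03.1], by linarith [q21.2, q12.2, q03.2]⟩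
  have r3 : |4 * (G₃ t * c 1 t) + 6 * (G₂ t * c 2 t) + 4 * (G₁ t * c 3 t) + G₀ t * c 4 t| ≤
      15 * (B * M) :=
    abs_le.2 ⟨by linarith [q31.1, q22.1, q13.1, q04.1], by linarith [q31.2, q22.2, q13.2, q04.2]⟩
  have shrink : ∀ {τ r D : ℝ}, 0 ≤ τ → τ ≤ 1 → |r| ≤ D → |τ * r| ≤ D := fun h0 h1 hr => by
    rw [abs_mul, abs_of_nonneg h0]
    exact (mul_le_of_le_one_left (abs_nonneg _) h1).trans hr
  have r2' := shrink ht0 (by linarith) r2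
  have r3' := shrink (sq_nonneg t) (pow_le_one₀ ht0 (by linarith)) r3
  have scale : ∀ {w r D : ℝ}, 0 ≤ w → |r| ≤ D → |w * r| ≤ w * D := fun h0 hr => by
    rw [abs_mul, abs_of_nonneg h0]; gcongr
  refine (abs_add_le _ _).trans (add_le_add ((abs_add_le _ _).trans (add_le_add ?_ ?_)) ?_)
  · exact scale (by positivity) r1
  · exact scale (by positivity) r2'
  · exact scale (by norm_num) r3'

end Representation

/-! ### Local representation by the Riesz kernel -/

section Kernel

/-- The Riesz kernel is locally integrable. -/
lemma integrableOn_norm_pow_inv_ball (k : ℕ) (r : ℝ) :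
    IntegrableOn (fun y : EuclideanSpace ℝ (Fin (k + 4)) => (‖y‖ ^ k)⁻¹) (ball 0 r) := by
  rw [← integrable_indicator_iff measurableSet_ball]
  have h : ((ball (0 : EuclideanSpace ℝ (Fin (k + 4))) r).indicator fun y => (‖y‖ ^ k)⁻¹) =
      fun y => (Set.Iio r).indicator (fun t : ℝ => (t ^ k)⁻¹) ‖y‖ := by
    ext y
    by_cases hy : ‖y‖ < r
    · rw [Set.indicator_of_mem (mem_ball_zero_iff.2 hy), Set.indicator_of_mem (Set.mem_Iio.2 hy)]
    · rw [Set.indicator_of_notMem (fun h => hy (mem_ball_zero_iff.1 h)),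
        Set.indicator_of_notMem (show ‖y‖ ∉ Set.Iio r from hy)]
  rw [h, integrable_fun_norm_addHaar (volume : Measure (EuclideanSpace ℝ (Fin (k + 4))))]
  simp only [finrank_euclideanSpace, Fintype.card_fin, smul_eq_mul]
  have h2 : IntegrableOn ((Set.Ioo 0 r).indicator fun t : ℝ => t ^ 3) (Set.Ioi 0) := by
    refine ((integrable_indicator_iff measurableSet_Ioo).2 ?_).integrableOn
    exact ((continuous_pow 3).continuousOn.integrableOn_compact
      (isCompact_Icc (a := (0 : ℝ)) (b := r))).mono_set Set.Ioo_subset_Icc_self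
  refine h2.congr_fun (fun t ht => ?_) measurableSet_Ioi
  have ht0 : 0 < t := ht
  by_cases htr : t < r
  · rw [Set.indicator_of_mem (show t ∈ Set.Ioo 0 r from ⟨ht0, htr⟩),
      Set.indicator_of_mem (Set.mem_Iio.2 htr), show k + 4 - 1 = 3 + k by omega, pow_add]
    field_simp
  · rw [Set.indicator_of_notMem (show t ∉ Set.Ioo 0 r from fun h => htr h.2),
      Set.indicator_of_notMem (show t ∉ Set.Iio r from htr),
      mul_zero]

lemma rpow_neg_half_sq (k : ℕ) {r : ℝ} (hr : 0 ≤ r) :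
    (r ^ 2) ^ (-(k / 2 : ℝ)) = (r ^ k)⁻¹ := by
  rw [Real.rpow_neg (sq_nonneg r), ← Real.rpow_natCast r 2, ← Real.rpow_mul hr,
    ← Real.rpow_natCast r k]
  congr 2
  push_cast
  ring

/-- The profile of the approximate identity is integrable. -/
lemma integrable_bubble (k : ℕ) : Integrable fun z : EuclideanSpace ℝ (Fin (k + 4)) =>
    (1 + ‖z‖ ^ 2) ^ (-(k / 2 : ℝ) - 4) := by
  have := integrable_rpow_neg_one_add_norm_sq (E := EuclideanSpace ℝ (Fin (k + 4)))
    (μ := volume) (r := k + 8) (by simp; norm_num)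
  refine this.congr (ae_of_all _ fun z => ?_)
  simp only
  congr 1
  ring

lemma tendsto_integral_bubble {k : ℕ} {w : EuclideanSpace ℝ (Fin (k + 4)) → ℝ}
    (hw : Continuous w) {D : ℝ} (hD : ∀ x, |w x| ≤ D) :
    Tendsto (fun ε : ℝ => ∫ x, w x * ((ε ^ 2) ^ 2 * (ε ^ 2 + ‖x‖ ^ 2) ^ (-(k / 2 : ℝ) - 4)))
      (nhdsWithin 0 (Set.Ioi 0))
      (nhds (w 0 * ∫ z : EuclideanSpace ℝ (Fin (k + 4)),
        (1 + ‖z‖ ^ 2) ^ (-(k / 2 : ℝ) - 4))) := by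
  have h1 : Tendsto (fun ε : ℝ => ∫ z, w (ε • z) * (1 + ‖z‖ ^ 2) ^ (-(k / 2 : ℝ) - 4))
      (nhdsWithin 0 (Set.Ioi 0)) (nhds (∫ z : EuclideanSpace ℝ (Fin (k + 4)),
        w 0 * (1 + ‖z‖ ^ 2) ^ (-(k / 2 : ℝ) - 4))) := by
    refine tendsto_integral_filter_of_dominated_convergence
      (fun z => D * (1 + ‖z‖ ^ 2) ^ (-(k / 2 : ℝ) - 4)) ?_ ?_ ((integrable_bubble k).const_mul D) ?_
    · refine Eventually.of_forall fun ε => ?_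
      exact (hw.comp (continuous_const_smul ε)).aestronglyMeasurable.mul
        (integrable_bubble k).aestronglyMeasurable
    · refine Eventually.of_forall fun ε => ae_of_all _ fun z => ?_
      rw [norm_mul, Real.norm_eq_abs, Real.norm_of_nonneg (by positivity)]
      gcongr
      exact hD _
    · refine ae_of_all _ fun z => Tendsto.mul_const _ ?_
      have : Continuous fun ε : ℝ => w (ε • z) := hw.comp (by fun_prop)
      have h := this.tendsto 0
      rw [zero_smul] at h
      exact h.mono_left nhdsWithin_le_nhds
  rw [integral_const_mul] at h1
  refine h1.congr' ?_
  filter_upwards [self_mem_nhdsWithin] with ε hε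
  have hε : 0 < ε := hε
  have h2 := Measure.integral_comp_smul (volume : Measure (EuclideanSpace ℝ (Fin (k + 4))))
    (fun x => w x * ((ε ^ 2) ^ 2 * (ε ^ 2 + ‖x‖ ^ 2) ^ (-(k / 2 : ℝ) - 4))) ε
  simp only [finrank_euclideanSpace, Fintype.card_fin, smul_eq_mul] at h2
  have hpos : 0 < ε ^ (k + 4) := by positivity
  rw [abs_of_pos (inv_pos.2 hpos)] at h2
  have h3 : ∀ z : EuclideanSpace ℝ (Fin (k + 4)), w (ε • z) * ((ε ^ 2) ^ 2 *
      (ε ^ 2 + ‖ε • z‖ ^ 2) ^ (-(k / 2 : ℝ) - 4)) =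
      (ε ^ (k + 4))⁻¹ * (w (ε • z) * (1 + ‖z‖ ^ 2) ^ (-(k / 2 : ℝ) - 4)) := by
    intro z
    rw [norm_smul, Real.norm_of_nonneg hε.le, mul_pow,
      show ε ^ 2 + ε ^ 2 * ‖z‖ ^ 2 = ε ^ 2 * (1 + ‖z‖ ^ 2) by ring,
      Real.mul_rpow (by positivity) (by positivity),
      show (-(k / 2 : ℝ) - 4) = -(((k + 8 : ℕ) : ℝ) / 2) by push_cast; ring,
      rpow_neg_half_sq _ hε.le]
    field_simp
    ring
  simp_rw [h3] at h2
  rw [integral_const_mul] at h2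
  exact mul_left_cancel₀ (inv_pos.2 hpos).ne' h2

/-- Localized representation formula: the value at the origin agrees with the localized Riesz
potential of the bilaplacian up to the mean of `u` over a ball. -/
lemma exists_abs_sub_integral_kernel_le {k : ℕ} (hk : 1 ≤ k) : ∃ c : ℝ, 0 < c ∧ ∃ C : ℝ, 0 ≤ C ∧
    ∀ u : EuclideanSpace ℝ (Fin (k + 4)) → ℝ, ContDiff ℝ 4 u → (∀ x, 0 ≤ u x) →
      |c * u 0 - ∫ y, (‖y‖ ^ k)⁻¹ * cutoff (‖y‖ ^ 2) * bilap u y| ≤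
        C * ∫ x in ball 0 (1 / 2), u x := by
  obtain ⟨C, hC0, hC⟩ := exists_bilap_regularized_kernel_sub_le k
  set J := ∫ z : EuclideanSpace ℝ (Fin (k + 4)), (1 + ‖z‖ ^ 2) ^ (-(k / 2 : ℝ) - 4) with hJ
  have hJ0 : 0 < J := by
    refine integral_pos_of_integrable_nonneg_nonzero (x := 0) ?_ (integrable_bubble k)
      (fun z => by positivity) (by simp)
    exact (by fun_prop : Continuous fun z : EuclideanSpace ℝ (Fin (k + 4)) =>
      1 + ‖z‖ ^ 2).rpow_const fun z => Or.inl (by positivity)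
  set Λ : ℝ := k * (k + 2) * (k + 4) * (k + 6) with hΛ
  have hΛ0 : 0 < Λ := by
    have : (0 : ℝ) < k := by exact_mod_cast hk
    positivity
  refine ⟨Λ * J, by positivity, C, hC0, fun u hu hpos => ?_⟩
  have hχc : Continuous fun x : EuclideanSpace ℝ (Fin (k + 4)) => cutoff (‖x‖ ^ 2) :=
    (contDiff_cutoff (m := 0)).continuous.comp (by fun_prop)
  have hχout : ∀ x : EuclideanSpace ℝ (Fin (k + 4)), x ∉ ball (0 : EuclideanSpace ℝ (Fin (k + 4)))
      (1 / 2) → cutoff (‖x‖ ^ 2) = 0 := fun x hx => by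
    rw [mem_ball_zero_iff, not_lt] at hx
    exact cutoff_eq_zero (by nlinarith)
  have hχs : HasCompactSupport fun x : EuclideanSpace ℝ (Fin (k + 4)) => cutoff (‖x‖ ^ 2) := by
    refine HasCompactSupport.of_support_subset_isCompact (isCompact_closedBall 0 (1 / 2))
      fun x hx => ?_
    by_contra h
    exact hx (hχout x fun h' => h (ball_subset_closedBall h'))
  set f := bilap u with hf
  have hfc : Continuous f := continuous_bilap hu
  set ψ : ℝ → EuclideanSpace ℝ (Fin (k + 4)) → ℝ := fun ε y =>
    (ε ^ 2 + ‖y‖ ^ 2) ^ (-(k / 2 : ℝ)) * cutoff (‖y‖ ^ 2) with hψ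
  have hψc : ∀ ε > 0, ContDiff ℝ 4 (ψ ε) := fun ε hε => by
    refine ContDiff.mul ?_ ((contDiff_cutoff (m := 4)).comp (contDiff_norm_sq ℝ))
    exact (contDiff_const.add (contDiff_norm_sq ℝ)).rpow_const_of_ne fun x => by positivity
  have hψs : ∀ ε, HasCompactSupport (ψ ε) := fun ε => hχs.mul_left
  have L1 : Tendsto (fun ε : ℝ => ∫ x, (u x * cutoff (‖x‖ ^ 2)) *
      ((ε ^ 2) ^ 2 * (ε ^ 2 + ‖x‖ ^ 2) ^ (-(k / 2 : ℝ) - 4)))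
      (nhdsWithin 0 (Set.Ioi 0)) (nhds ((u 0 * cutoff (‖(0 : EuclideanSpace ℝ (Fin (k + 4)))‖ ^ 2))
        * J)) := by
    obtain ⟨D, hD⟩ := (hχs.mul_left (f := u)).exists_bound_of_continuous (hu.continuous.mul hχc)
    exact tendsto_integral_bubble (hu.continuous.mul hχc) hD
  rw [norm_zero, cutoff_eq_one (by norm_num), mul_one] at L1
  have L2 : Tendsto (fun ε : ℝ => ∫ x, f x * ψ ε x) (nhdsWithin 0 (Set.Ioi 0))
      (nhds (∫ y, (‖y‖ ^ k)⁻¹ * cutoff (‖y‖ ^ 2) * f y)) := by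
    obtain ⟨D, hD⟩ := (hχs.mul_left (f := f)).exists_bound_of_continuous (hfc.mul hχc)
    have hint : Integrable ((ball (0 : EuclideanSpace ℝ (Fin (k + 4))) (1 / 2)).indicator
        fun y => D * (‖y‖ ^ k)⁻¹) :=
      (integrable_indicator_iff measurableSet_ball).2
        ((integrableOn_norm_pow_inv_ball k _).const_mul D)
    refine tendsto_integral_filter_of_dominated_convergence _ ?_ ?_ hint ?_
    · filter_upwards [self_mem_nhdsWithin] with ε hε
      exact (hfc.mul (hψc ε hε).continuous).aestronglyMeasurable
    · filter_upwards [self_mem_nhdsWithin] with ε hε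
      have h0 : ∀ᵐ x : EuclideanSpace ℝ (Fin (k + 4)), x ≠ 0 := Measure.ae_ne volume 0
      filter_upwards [h0] with x hx0
      by_cases hx : x ∈ ball (0 : EuclideanSpace ℝ (Fin (k + 4))) (1 / 2)
      · rw [Set.indicator_of_mem hx]
        have hn : 0 < ‖x‖ := norm_pos_iff.2 hx0
        have e : f x * ψ ε x = (f x * cutoff (‖x‖ ^ 2)) * (ε ^ 2 + ‖x‖ ^ 2) ^ (-(k / 2 : ℝ)) := by
          simp only [hψ]; ring
        have hb : (ε ^ 2 + ‖x‖ ^ 2) ^ (-(k / 2 : ℝ)) ≤ (‖x‖ ^ k)⁻¹ := by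
          rw [← rpow_neg_half_sq k hn.le]
          refine Real.rpow_le_rpow_of_nonpos (by positivity) ?_ (by simp; positivity)
          nlinarith [sq_nonneg ε]
        rw [e, norm_mul, Real.norm_of_nonneg (Real.rpow_nonneg (by positivity) _)]
        exact mul_le_mul (hD x) hb (Real.rpow_nonneg (by positivity) _)
          ((norm_nonneg _).trans (hD x))
      · rw [Set.indicator_of_notMem hx]
        simp [hψ, hχout x hx]
    · have h0 : ∀ᵐ x : EuclideanSpace ℝ (Fin (k + 4)), x ≠ 0 := Measure.ae_ne volume 0
      filter_upwards [h0] with x hx0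
      have hn : 0 < ‖x‖ := norm_pos_iff.2 hx0
      have hcont : ContinuousAt (fun ε : ℝ => (ε ^ 2 + ‖x‖ ^ 2) ^ (-(k / 2 : ℝ))) 0 := by
        refine ContinuousAt.rpow_const (by fun_prop) (Or.inl ?_)
        positivity
      have h := hcont.tendsto.mono_left (nhdsWithin_le_nhds (s := Set.Ioi 0))
      simp only [ne_eq, OfNat.ofNat_ne_zero, not_false_eq_true, zero_pow, zero_add] at h
      rw [rpow_neg_half_sq k hn.le] at h
      have h2 := (h.mul_const (cutoff (‖x‖ ^ 2))).const_mul (f x)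
      rw [mul_comm] at h2
      exact h2
  have hlim := ((L1.const_mul Λ).sub L2).abs
  rw [show Λ * (u 0 * J) = Λ * J * u 0 by ring] at hlim
  refine le_of_tendsto hlim ?_
  filter_upwards [self_mem_nhdsWithin] with ε hε
  have hε : 0 < ε := hε
  have hb := hC (ε ^ 2) (by positivity)
  have hκ : Continuous fun x : EuclideanSpace ℝ (Fin (k + 4)) =>
      ((ε ^ 2) ^ 2 * (ε ^ 2 + ‖x‖ ^ 2) ^ (-(k / 2 : ℝ) - 4)) := by
    refine continuous_const.mul (Continuous.rpow_const (by fun_prop) fun x => Or.inl ?_)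
    positivity
  have j1 : Integrable fun x => u x * cutoff (‖x‖ ^ 2) *
      ((ε ^ 2) ^ 2 * (ε ^ 2 + ‖x‖ ^ 2) ^ (-(k / 2 : ℝ) - 4)) :=
    ((hu.continuous.mul hχc).mul hκ).integrable_of_hasCompactSupport (hχs.mul_left.mul_right)
  have j2 : Integrable fun x => u x * bilap (ψ ε) x :=
    (hu.continuous.mul (continuous_bilap (hψc ε hε))).integrable_of_hasCompactSupport
      (hasCompactSupport_lap (hasCompactSupport_lap (hψs ε))).mul_left
  rw [hf, ← integral_mul_bilap hu (hψc ε hε) (hψs ε), ← integral_const_mul,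
    ← integral_sub (j1.const_mul Λ) j2, ← integral_const_mul,
    ← integral_indicator (measurableSet_ball (x := (0 : EuclideanSpace ℝ (Fin (k + 4))))
      (ε := 1 / 2))]
  rw [← Real.norm_eq_abs]
  refine norm_integral_le_of_norm_le ?_ (ae_of_all _ fun x => ?_)
  · rw [integrable_indicator_iff measurableSet_ball]
    exact ((hu.continuous.continuousOn.integrableOn_compact
      (isCompact_closedBall 0 (1 / 2))).mono_set ball_subset_closedBall).const_mul C
  · have h1 := hb x
    rw [show Λ * (u x * cutoff (‖x‖ ^ 2) * ((ε ^ 2) ^ 2 * (ε ^ 2 + ‖x‖ ^ 2) ^ (-(k / 2 : ℝ) - 4))) -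
      u x * bilap (ψ ε) x = -(u x * (bilap (ψ ε) x - cutoff (‖x‖ ^ 2) *
        (Λ * ((ε ^ 2) ^ 2 * (ε ^ 2 + ‖x‖ ^ 2) ^ (-(k / 2 : ℝ) - 4))))) by ring, norm_neg, norm_mul,
      Real.norm_of_nonneg (hpos x)]
    refine (mul_le_mul_of_nonneg_left h1 (hpos x)).trans_eq ?_
    by_cases hx : x ∈ ball (0 : EuclideanSpace ℝ (Fin (k + 4))) (1 / 2)
    · rw [Set.indicator_of_mem hx, Set.indicator_of_mem hx, mul_comm]
    · rw [Set.indicator_of_notMem hx, Set.indicator_of_notMem hx, mul_zero]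

end Kernel

/-! ### The Riesz potential representation of entire solutions -/

section RieszRepresentation

lemma integrableOn_kernel_mul_ball {k : ℕ} {w : EuclideanSpace ℝ (Fin (k + 4)) → ℝ}
    (hw : Continuous w) (r : ℝ) :
    IntegrableOn (fun z => (‖z‖ ^ k)⁻¹ * w z) (ball 0 r) :=
  (integrableOn_norm_pow_inv_ball k r).mul_continuousOn_of_subset hw.continuousOn
    measurableSet_ball (isCompact_closedBall 0 r) ball_subset_closedBall

/-- The scaling invariance of the equation. -/
lemma bilap_rescale {n : ℕ} {p : ℝ} (hp : 1 < p) {u : EuclideanSpace ℝ (Fin n) → ℝ}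
    (hu : ContDiff ℝ 4 u) (h0 : ∀ x, 0 ≤ u x) (he : ∀ x, bilap u x = u x ^ p) {R : ℝ}
    (hR : 0 < R) (x₀ x : EuclideanSpace ℝ (Fin n)) :
    bilap (fun y => R ^ (4 / (p - 1)) * u (R • y + x₀)) x =
      (R ^ (4 / (p - 1)) * u (R • x + x₀)) ^ p := by
  rw [bilap_const_mul_comp_affine hu, he, Real.mul_rpow (by positivity) (h0 _),
    ← Real.rpow_mul hR.le, ← Real.rpow_natCast R 4, ← Real.rpow_add hR]
  congr 2
  have : p - 1 ≠ 0 := by linarith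
  push_cast
  field_simp
  ring

lemma exists_integral_rescale_le (n : ℕ) {p : ℝ} (hp : 1 < p) : ∃ C, 0 ≤ C ∧
    ∀ u : EuclideanSpace ℝ (Fin n) → ℝ, ContDiff ℝ 4 u → (∀ x, 0 ≤ u x) →
      (∀ x, bilap u x = u x ^ p) → ∀ R > 0, ∀ x₀,
        ∫ x in ball 0 (1 / 2), R ^ (4 / (p - 1)) * u (R • x + x₀) ≤ C := by
  obtain ⟨C, hC0, hC⟩ := exists_integral_ball_le n hp
  refine ⟨C, hC0, fun u hu h0 he R hR x₀ => hC _ ?_ (fun x => ?_) fun x => ?_⟩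
  · exact contDiff_const.mul (hu.comp (by fun_prop))
  · exact mul_nonneg (by positivity) (h0 _)
  · exact bilap_rescale hp hu h0 he hR x₀ x

lemma integral_kernel_rescale {k : ℕ} (w : EuclideanSpace ℝ (Fin (k + 4)) → ℝ) {R : ℝ}
    (hR : 0 < R) :
    ∫ z, (‖z‖ ^ k)⁻¹ * w z =
      R ^ 4 * ∫ y : EuclideanSpace ℝ (Fin (k + 4)), (‖y‖ ^ k)⁻¹ * w (R • y) := by
  have h := Measure.integral_comp_smul (volume : Measure (EuclideanSpace ℝ (Fin (k + 4))))
    (fun z => (‖z‖ ^ k)⁻¹ * w z) R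
  simp only [finrank_euclideanSpace, Fintype.card_fin, smul_eq_mul] at h
  rw [abs_of_pos (by positivity)] at h
  have e : ∀ y : EuclideanSpace ℝ (Fin (k + 4)), (‖R • y‖ ^ k)⁻¹ * w (R • y) =
      (R ^ k)⁻¹ * ((‖y‖ ^ k)⁻¹ * w (R • y)) := fun y => by
    rw [norm_smul, Real.norm_of_nonneg hR.le, mul_pow, mul_inv, mul_assoc]
  simp_rw [e] at h
  rw [integral_const_mul, pow_add] at h
  generalize (∫ y : EuclideanSpace ℝ (Fin (k + 4)), (‖y‖ ^ k)⁻¹ * w (R • y)) = J at h ⊢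
  generalize ∫ z, (‖z‖ ^ k)⁻¹ * w z = I at h ⊢
  field_simp at h
  linarith

/-- Entire solutions are represented by their Riesz potential. -/
lemma exists_riesz_representation {k : ℕ} (hk : 1 ≤ k) {p : ℝ} (hp : 1 < p) : ∃ c : ℝ, 0 < c ∧
    ∀ u : EuclideanSpace ℝ (Fin (k + 4)) → ℝ, ContDiff ℝ 4 u → (∀ x, 0 ≤ u x) →
      (∀ x, bilap u x = u x ^ p) → ∀ x,
        Integrable (fun y => (‖x - y‖ ^ k)⁻¹ * u y ^ p) ∧
          c * u x = ∫ y, (‖x - y‖ ^ k)⁻¹ * u y ^ p := by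
  obtain ⟨c, hc, C₁, hC₁, H₁⟩ := exists_abs_sub_integral_kernel_le hk
  obtain ⟨C₂, hC₂, H₂⟩ := exists_integral_rescale_le (k + 4) hp
  refine ⟨c, hc, fun u hu h0 he x₀ => ?_⟩
  have hupc : Continuous fun x => u x ^ p :=
    hu.continuous.rpow_const fun x => Or.inr (by linarith)
  set w : EuclideanSpace ℝ (Fin (k + 4)) → ℝ := fun z => u (z + x₀) ^ p with hw
  have hwc : Continuous w := hupc.comp (by fun_prop)
  have hw0 : ∀ z, 0 ≤ w z := fun z => Real.rpow_nonneg (h0 _) _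
  set a := 4 / (p - 1) with ha
  have ha0 : 0 < a := div_pos (by norm_num) (by linarith)
  have key : ∀ R : ℝ, 0 < R →
      |c * u x₀ - ∫ z, (‖z‖ ^ k)⁻¹ * (cutoff (‖R⁻¹ • z‖ ^ 2) * w z)| ≤ (C₁ * C₂) * R ^ (-a) := by
    intro R hR
    have hRa : 0 < R ^ a := by positivity
    have h1 := H₁ (fun y => R ^ a * u (R • y + x₀))
      (contDiff_const.mul (hu.comp (by fun_prop))) fun x => mul_nonneg hRa.le (h0 _)
    have h2 := H₂ u hu h0 he R hR x₀
    have h3 := h1.trans (mul_le_mul_of_nonneg_left h2 hC₁)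
    have h4 : ∀ y, (‖y‖ ^ k)⁻¹ * cutoff (‖y‖ ^ 2) *
        bilap (fun y => R ^ a * u (R • y + x₀)) y = R ^ a * R ^ 4 * ((‖y‖ ^ k)⁻¹ *
          (cutoff (‖R⁻¹ • R • y‖ ^ 2) * w (R • y))) := fun y => by
      rw [bilap_const_mul_comp_affine hu, he, inv_smul_smul₀ hR.ne']
      ring
    simp_rw [h4] at h3
    rw [integral_const_mul, mul_assoc (R ^ a), ← integral_kernel_rescale
      (fun z => cutoff (‖R⁻¹ • z‖ ^ 2) * w z) hR, smul_zero, zero_add, mul_left_comm,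
      ← mul_sub, abs_mul, abs_of_pos hRa] at h3
    rw [Real.rpow_neg hR.le, ← div_eq_mul_inv, le_div_iff₀ hRa, mul_comm]
    exact h3
  have hcut : ∀ R : ℝ, 0 < R →
      Integrable fun z => (‖z‖ ^ k)⁻¹ * (cutoff (‖R⁻¹ • z‖ ^ 2) * w z) := by
    intro R hR
    have hc : Continuous fun z => cutoff (‖R⁻¹ • z‖ ^ 2) * w z :=
      ((contDiff_cutoff (m := 0)).continuous.comp (by fun_prop)).mul hwc
    refine (integrableOn_kernel_mul_ball hc R).integrable_of_forall_notMem_eq_zero fun z hz => ?_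
    rw [mem_ball_zero_iff, not_lt] at hz
    rw [cutoff_eq_zero, zero_mul, mul_zero]
    rw [norm_smul, norm_inv, Real.norm_of_nonneg hR.le]
    have : 1 ≤ R⁻¹ * ‖z‖ := by rw [inv_mul_eq_div, one_le_div hR]; exact hz
    nlinarith
  have hle : ∀ (R : ℝ) z, (‖z‖ ^ k)⁻¹ * (cutoff (‖R⁻¹ • z‖ ^ 2) * w z) ≤ (‖z‖ ^ k)⁻¹ * w z :=
    fun R z =>
    mul_le_mul_of_nonneg_left (mul_le_of_le_one_left (hw0 z) (cutoff_le_one _)) (by positivity)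
  have hge : ∀ (R : ℝ) z, 0 ≤ (‖z‖ ^ k)⁻¹ * (cutoff (‖R⁻¹ • z‖ ^ 2) * w z) := fun R z =>
    mul_nonneg (by positivity) (mul_nonneg (cutoff_nonneg _) (hw0 z))
  have hone : ∀ (R : ℝ) (z : EuclideanSpace ℝ (Fin (k + 4))), 0 < R → ‖z‖ < R / 3 →
      cutoff (‖R⁻¹ • z‖ ^ 2) = 1 := fun R z hR hz => by
    refine cutoff_eq_one ?_
    rw [norm_smul, norm_inv, Real.norm_of_nonneg hR.le]
    have : R⁻¹ * ‖z‖ < 1 / 3 := by rw [inv_mul_eq_div, div_lt_iff₀ hR]; linarith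
    have : 0 ≤ R⁻¹ * ‖z‖ := by positivity
    nlinarith
  have hint : Integrable fun z => (‖z‖ ^ k)⁻¹ * w z := by
    refine (aecover_ball (μ := volume) (x := (0 : EuclideanSpace ℝ (Fin (k + 4))))
      (r := fun R : ℝ => R / 3) (l := atTop)
      (tendsto_id.atTop_div_const (by norm_num))).integrable_of_integral_norm_bounded
      (c * u x₀ + C₁ * C₂) (fun R => integrableOn_kernel_mul_ball hwc _) ?_
    filter_upwards [eventually_ge_atTop 1] with R hR
    have hR0 : 0 < R := by linarith
    have h1 : ∫ z in ball 0 (R / 3), ‖(‖z‖ ^ k)⁻¹ * w z‖ ≤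
        ∫ z, (‖z‖ ^ k)⁻¹ * (cutoff (‖R⁻¹ • z‖ ^ 2) * w z) := by
      rw [setIntegral_congr_fun (g := fun z => (‖z‖ ^ k)⁻¹ * (cutoff (‖R⁻¹ • z‖ ^ 2) * w z))
        measurableSet_ball fun z hz => ?_]
      · exact setIntegral_le_integral (hcut R hR0) (ae_of_all _ (hge R))
      · simp only
        rw [Real.norm_of_nonneg (mul_nonneg (by positivity) (hw0 z)),
          hone R z hR0 (mem_ball_zero_iff.1 hz), one_mul]
    have h2 := (abs_le.1 (key R hR0)).1
    have h3 : R ^ (-a) ≤ 1 := Real.rpow_le_one_of_one_le_of_nonpos hR (by linarith)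
    have h4 : C₁ * C₂ * R ^ (-a) ≤ C₁ * C₂ := mul_le_of_le_one_right (mul_nonneg hC₁ hC₂) h3
    linarith
  have hlim1 : Tendsto (fun R : ℝ => ∫ z, (‖z‖ ^ k)⁻¹ * (cutoff (‖R⁻¹ • z‖ ^ 2) * w z)) atTop
      (nhds (∫ z, (‖z‖ ^ k)⁻¹ * w z)) := by
    refine tendsto_integral_filter_of_dominated_convergence _ ?_ ?_ hint ?_
    · filter_upwards [eventually_gt_atTop 0] with R hR
      exact (hcut R hR).aestronglyMeasurable
    · refine Eventually.of_forall fun R => ae_of_all _ fun z => ?_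
      rw [Real.norm_of_nonneg (hge R z)]
      exact hle R z
    · refine ae_of_all _ fun z => tendsto_const_nhds.congr' ?_
      filter_upwards [eventually_gt_atTop 0, eventually_gt_atTop (3 * ‖z‖)] with R hR hRz
      rw [hone R z hR (by linarith), one_mul]
  have hlim2 : Tendsto (fun R : ℝ => ∫ z, (‖z‖ ^ k)⁻¹ * (cutoff (‖R⁻¹ • z‖ ^ 2) * w z)) atTop
      (nhds (c * u x₀)) := by
    rw [tendsto_iff_norm_sub_tendsto_zero]
    have h5 := (tendsto_rpow_neg_atTop ha0).const_mul (C₁ * C₂)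
    rw [mul_zero] at h5
    refine squeeze_zero' (Eventually.of_forall fun R => norm_nonneg _) ?_ h5
    filter_upwards [eventually_gt_atTop 0] with R hR
    rw [norm_sub_rev]
    exact key R hR
  have heq := tendsto_nhds_unique hlim2 hlim1
  have hsub : ∀ y, (‖x₀ - y‖ ^ k)⁻¹ * u y ^ p = (‖y - x₀‖ ^ k)⁻¹ * w (y - x₀) := fun y => by
    rw [norm_sub_rev, hw]
    simp
  simp_rw [hsub]
  exact ⟨hint.comp_sub_right x₀,
    heq.trans (integral_sub_right_eq_self (fun z => (‖z‖ ^ k)⁻¹ * w z) x₀).symm⟩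

end RieszRepresentation

/-! ### Inversion as a change of variables -/

section Inversion

variable {n : ℕ}

/-- The inversion in the sphere of radius `r` centred at the origin. -/
noncomputable def inv₀ (r : ℝ) (z : EuclideanSpace ℝ (Fin n)) : EuclideanSpace ℝ (Fin n) :=
  (r / ‖z‖) ^ 2 • z

lemma inv₀_eq_inversion (r : ℝ) :
    (inv₀ r : EuclideanSpace ℝ (Fin n) → _) = EuclideanGeometry.inversion 0 r := by
  ext1 z
  simp [inv₀, EuclideanGeometry.inversion]

lemma norm_inv₀ (r : ℝ) {z : EuclideanSpace ℝ (Fin n)} (hz : z ≠ 0) :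
    ‖inv₀ r z‖ = r ^ 2 / ‖z‖ := by
  have : ‖z‖ ≠ 0 := norm_ne_zero_iff.2 hz
  rw [inv₀, norm_smul, Real.norm_of_nonneg (by positivity)]
  field_simp

lemma measurable_inv₀ (r : ℝ) : Measurable (inv₀ r : EuclideanSpace ℝ (Fin n) → _) := by
  unfold inv₀
  fun_prop

/-- The punctured open ball around the origin. -/
def pball (n : ℕ) (r : ℝ) : Set (EuclideanSpace ℝ (Fin n)) := {z | 0 < ‖z‖ ∧ ‖z‖ < r}

lemma measurableSet_pball (r : ℝ) : MeasurableSet (pball n r) :=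
  (measurableSet_lt measurable_const measurable_norm).inter
    (measurableSet_lt measurable_norm measurable_const)

lemma ne_zero_of_mem_pball {r : ℝ} {z : EuclideanSpace ℝ (Fin n)} (hz : z ∈ pball n r) : z ≠ 0 :=
  norm_pos_iff.1 hz.1

lemma image_inv₀_pball {r : ℝ} (hr : 0 < r) : inv₀ r '' pball n r = {z | r < ‖z‖} := by
  ext z
  constructor
  · rintro ⟨y, hy, rfl⟩
    have h1 := hy.1
    have h2 := hy.2
    rw [Set.mem_ofPred_eq, norm_inv₀ r (ne_zero_of_mem_pball hy), lt_div_iff₀ h1, sq]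
    gcongr
  · intro hz
    have hz : r < ‖z‖ := hz
    have hz0 : 0 < ‖z‖ := hr.trans hz
    refine ⟨inv₀ r z, ⟨?_, ?_⟩, ?_⟩
    · rw [norm_inv₀ r (norm_pos_iff.1 hz0)]
      positivity
    · rw [norm_inv₀ r (norm_pos_iff.1 hz0), div_lt_iff₀ hz0, sq]
      gcongr
    · rw [inv₀_eq_inversion, EuclideanGeometry.inversion_inversion _ hr.ne']

lemma integral_eq_integral_pball {r : ℝ} (hr : 0 < r) {F : EuclideanSpace ℝ (Fin n) → ℝ}
    (hn : 0 < n) (hF : Integrable F) :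
    IntegrableOn F (pball n r) ∧
    IntegrableOn (fun z => (r / ‖z‖) ^ (2 * n) * F (inv₀ r z)) (pball n r) ∧
    ∫ z, F z = ∫ z in pball n r, (F z + (r / ‖z‖) ^ (2 * n) * F (inv₀ r z)) := by
  have hd : ∀ z ∈ pball n r, HasFDerivWithinAt (inv₀ r)
      ((r / dist z 0) ^ 2 • ((ℝ ∙ (z - 0))ᗮ.reflection :
        EuclideanSpace ℝ (Fin n) →L[ℝ] EuclideanSpace ℝ (Fin n))) (pball n r) z := by
    intro z hz
    rw [inv₀_eq_inversion]
    exact (EuclideanGeometry.hasFDerivAt_inversion (ne_zero_of_mem_pball hz)).hasFDerivWithinAt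
  have hinj : Set.InjOn (inv₀ r) (pball n r) := by
    rw [inv₀_eq_inversion]
    exact (EuclideanGeometry.inversion_injective _ hr.ne').injOn
  have hdet : ∀ z : EuclideanSpace ℝ (Fin n), |((r / dist z 0) ^ 2 • ((ℝ ∙ (z - 0))ᗮ.reflection :
        EuclideanSpace ℝ (Fin n) →L[ℝ] EuclideanSpace ℝ (Fin n))).det| = (r / ‖z‖) ^ (2 * n) := by
    intro z
    have h1 : LinearMap.det ((r / ‖z‖) ^ 2 • ((ℝ ∙ (z - 0))ᗮ.reflection.toLinearMap)) =
      ((r / ‖z‖) ^ 2) ^ n * LinearMap.det ((ℝ ∙ (z - 0))ᗮ.reflection.toLinearMap) := by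
      rw [LinearMap.det_smul, finrank_euclideanSpace, Fintype.card_fin]
    rw [Submodule.det_reflection] at h1
    rw [dist_zero_right]
    refine (congrArg abs h1).trans ?_
    rw [abs_mul, abs_neg_one_pow, mul_one, abs_of_nonneg (by positivity), ← pow_mul]
  have h1 := integrableOn_image_iff_integrableOn_abs_det_fderiv_smul volume
    (measurableSet_pball r) hd hinj F
  have h2 := integral_image_eq_integral_abs_det_fderiv_smul volume
    (measurableSet_pball r) hd hinj F
  simp_rw [hdet, smul_eq_mul, image_inv₀_pball hr] at h1 h2
  have h3 := h1.1 hF.integrableOn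
  refine ⟨hF.integrableOn, h3, ?_⟩
  rw [integral_add hF.integrableOn h3, ← h2,
    ← integral_add_compl (measurableSet_pball r) hF]
  congr 1
  refine setIntegral_congr_set ?_
  have : NeZero n := ⟨hn.ne'⟩
  have s1 : ∀ᵐ z : EuclideanSpace ℝ (Fin n), z ≠ 0 := Measure.ae_ne volume 0
  have s2 : ∀ᵐ z : EuclideanSpace ℝ (Fin n), z ∉ sphere 0 r :=
    measure_eq_zero_iff_ae_notMem.1 (Measure.addHaar_sphere_of_ne_zero volume 0 hr.ne')
  filter_upwards [s1, s2] with z hz1 hz2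
  rw [mem_sphere_zero_iff_norm] at hz2
  refine propext (show z ∈ (pball n r)ᶜ ↔ r < ‖z‖ from ?_)
  rw [Set.mem_compl_iff, pball, Set.mem_ofPred_eq, not_and, not_lt]
  exact ⟨fun h => lt_of_le_of_ne (h (norm_pos_iff.2 hz1)) (Ne.symm hz2), fun h _ => h.le⟩

end Inversion

/-! ### The Kelvin transform -/

section Kelvin

lemma sq_norm_mul_norm_sub_inv₀ {n : ℕ} {r : ℝ} (hr : 0 < r) (x : EuclideanSpace ℝ (Fin n))
    {z : EuclideanSpace ℝ (Fin n)} (hz : z ≠ 0) :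
    (‖z‖ / r * ‖x - inv₀ r z‖) ^ 2 = ‖x‖ ^ 2 * ‖z‖ ^ 2 / r ^ 2 - 2 * inner ℝ x z + r ^ 2 := by
  have : ‖z‖ ≠ 0 := norm_ne_zero_iff.2 hz
  rw [mul_pow, norm_sub_sq_real, norm_inv₀ r hz, inv₀, inner_smul_right]
  field_simp

/-- The Riesz kernel with pole reflected in the sphere of radius `r`. -/
noncomputable def reflectedKernel (k : ℕ) (r : ℝ) {n : ℕ} (x z : EuclideanSpace ℝ (Fin n)) : ℝ :=
  ((‖z‖ / r * ‖x - inv₀ r z‖) ^ k)⁻¹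

lemma reflectedKernel_comm (k : ℕ) {n : ℕ} {r : ℝ} (hr : 0 < r) {x z : EuclideanSpace ℝ (Fin n)}
    (hx : x ≠ 0) (hz : z ≠ 0) : reflectedKernel k r x z = reflectedKernel k r z x := by
  have h : ‖z‖ / r * ‖x - inv₀ r z‖ = ‖x‖ / r * ‖z - inv₀ r x‖ := by
    rw [← pow_left_inj₀ (by positivity) (by positivity) two_ne_zero,
      sq_norm_mul_norm_sub_inv₀ hr x hz, sq_norm_mul_norm_sub_inv₀ hr z hx, real_inner_comm]
    ring
  rw [reflectedKernel, reflectedKernel, h]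

lemma reflectedKernel_nonneg (k : ℕ) {n : ℕ} {r : ℝ} (hr : 0 < r)
    (x z : EuclideanSpace ℝ (Fin n)) : 0 ≤ reflectedKernel k r x z := by
  rw [reflectedKernel]
  positivity

lemma reflectedKernel_lt {k : ℕ} (hk : 1 ≤ k) {n : ℕ} {r : ℝ} {x z : EuclideanSpace ℝ (Fin n)}
    (hx : x ∈ pball n r) (hz : z ∈ pball n r) (hxz : x ≠ z) :
    reflectedKernel k r x z < (‖x - z‖ ^ k)⁻¹ := by
  have hr : 0 < r := hx.1.trans hx.2
  have h0 : 0 < ‖x - z‖ := norm_pos_iff.2 (sub_ne_zero.2 hxz)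
  rw [reflectedKernel]
  refine inv_strictAnti₀ (by positivity) (pow_lt_pow_left₀ ?_ h0.le (by omega))
  refine lt_of_pow_lt_pow_left₀ 2 (by positivity) ?_
  rw [sq_norm_mul_norm_sub_inv₀ hr x (ne_zero_of_mem_pball hz), norm_sub_sq_real]
  have h1 : 0 < r ^ 2 - ‖x‖ ^ 2 := by nlinarith [hx.1, hx.2]
  have h2 : 0 < r ^ 2 - ‖z‖ ^ 2 := by nlinarith [hz.1, hz.2]
  have h3 : ‖x‖ ^ 2 * ‖z‖ ^ 2 / r ^ 2 + r ^ 2 - ‖x‖ ^ 2 - ‖z‖ ^ 2 =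
      (r ^ 2 - ‖x‖ ^ 2) * (r ^ 2 - ‖z‖ ^ 2) / r ^ 2 := by
    field_simp
    ring
  have h4 : 0 < (r ^ 2 - ‖x‖ ^ 2) * (r ^ 2 - ‖z‖ ^ 2) / r ^ 2 := by positivity
  linarith

/-- The Kelvin transform. -/
noncomputable def kelvin {k : ℕ} (u : EuclideanSpace ℝ (Fin (k + 4)) → ℝ) (r : ℝ)
    (z : EuclideanSpace ℝ (Fin (k + 4))) : ℝ :=
  (r / ‖z‖) ^ k * u (inv₀ r z)

/-- Representation of the difference of a solution and its Kelvin transform. -/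
lemma sub_kelvin_eq_integral {k : ℕ} {c p : ℝ} {u : EuclideanSpace ℝ (Fin (k + 4)) → ℝ}
    (hrep : ∀ x, Integrable (fun y => (‖x - y‖ ^ k)⁻¹ * u y ^ p) ∧
      c * u x = ∫ y, (‖x - y‖ ^ k)⁻¹ * u y ^ p) {r : ℝ} {x : EuclideanSpace ℝ (Fin (k + 4))}
    (hx : x ∈ pball (k + 4) r) :
    IntegrableOn (fun z => ((‖x - z‖ ^ k)⁻¹ - reflectedKernel k r x z) *
      (u z ^ p - (r / ‖z‖) ^ (k + 8) * u (inv₀ r z) ^ p)) (pball (k + 4) r) ∧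
    c * (u x - kelvin u r x) = ∫ z in pball (k + 4) r,
      ((‖x - z‖ ^ k)⁻¹ - reflectedKernel k r x z) *
      (u z ^ p - (r / ‖z‖) ^ (k + 8) * u (inv₀ r z) ^ p) := by
  have hr : 0 < r := hx.1.trans hx.2
  have hx0 := ne_zero_of_mem_pball hx
  have hxn := hx.1
  obtain ⟨a1, a2, a3⟩ := integral_eq_integral_pball hr (by omega) (hrep x).1
  obtain ⟨b1, b2, b3⟩ := integral_eq_integral_pball hr (by omega) (hrep (inv₀ r x)).1
  have hb := ((b1.add b2).const_mul ((r / ‖x‖) ^ k))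
  have e : Set.EqOn (fun z => ((‖x - z‖ ^ k)⁻¹ * u z ^ p + (r / ‖z‖) ^ (2 * (k + 4)) *
        ((‖x - inv₀ r z‖ ^ k)⁻¹ * u (inv₀ r z) ^ p)) - (r / ‖x‖) ^ k *
        ((‖inv₀ r x - z‖ ^ k)⁻¹ * u z ^ p + (r / ‖z‖) ^ (2 * (k + 4)) *
        ((‖inv₀ r x - inv₀ r z‖ ^ k)⁻¹ * u (inv₀ r z) ^ p)))
      (fun z => ((‖x - z‖ ^ k)⁻¹ - reflectedKernel k r x z) *
      (u z ^ p - (r / ‖z‖) ^ (k + 8) * u (inv₀ r z) ^ p)) (pball (k + 4) r) := by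
    intro z hz
    have hz0 := ne_zero_of_mem_pball hz
    have hzn := hz.1
    have i1 : (r / ‖z‖) ^ (2 * (k + 4)) * (‖x - inv₀ r z‖ ^ k)⁻¹ =
        reflectedKernel k r x z * (r / ‖z‖) ^ (k + 8) := by
      rw [reflectedKernel, mul_pow, mul_inv, show 2 * (k + 4) = k + (k + 8) by ring,
        pow_add _ k (k + 8), ← inv_pow (‖z‖ / r), inv_div]
      ring
    have i2 : (r / ‖x‖) ^ k * (‖inv₀ r x - z‖ ^ k)⁻¹ = reflectedKernel k r x z := by
      rw [reflectedKernel_comm k hr hx0 hz0, reflectedKernel, mul_pow, mul_inv,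
        ← inv_pow (‖x‖ / r), inv_div, norm_sub_rev]
    have i3 : (r / ‖x‖) ^ k * ((r / ‖z‖) ^ (2 * (k + 4)) * (‖inv₀ r x - inv₀ r z‖ ^ k)⁻¹) =
        (‖x - z‖ ^ k)⁻¹ * (r / ‖z‖) ^ (k + 8) := by
      have h := EuclideanGeometry.dist_inversion_inversion hx0 hz0 r
      rw [dist_zero_right, dist_zero_right, dist_eq_norm, dist_eq_norm, ← inv₀_eq_inversion] at h
      have h' : r ^ 2 / (‖x‖ * ‖z‖) = (r / ‖x‖) * (r / ‖z‖) := by field_simp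
      have p1 : (r / ‖x‖) ^ k ≠ 0 := by positivity
      have p2 : (r / ‖z‖) ^ k ≠ 0 := by positivity
      rw [h, h', show 2 * (k + 4) = k + (k + 8) by ring, pow_add _ k (k + 8), mul_pow, mul_pow,
        mul_inv, mul_inv]
      calc _ = ((r / ‖x‖) ^ k * ((r / ‖x‖) ^ k)⁻¹) * ((r / ‖z‖) ^ k * ((r / ‖z‖) ^ k)⁻¹) *
            ((‖x - z‖ ^ k)⁻¹ * (r / ‖z‖) ^ (k + 8)) := by ring
        _ = _ := by rw [mul_inv_cancel₀ p1, mul_inv_cancel₀ p2, one_mul, one_mul]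
    simp only
    linear_combination u (inv₀ r z) ^ p * i1 - u z ^ p * i2 - u (inv₀ r z) ^ p * i3
  have hint := (a1.add a2).sub hb
  refine ⟨IntegrableOn.congr_fun hint e (measurableSet_pball r), ?_⟩
  have hs := integral_sub (a1.add a2) hb
  simp only [Pi.add_apply] at hs
  rw [← setIntegral_congr_fun (measurableSet_pball r) e, hs,
    integral_const_mul, ← a3, ← b3, ← (hrep x).2, ← (hrep _).2, kelvin]
  ring

end Kelvin

/-! ### The method of moving spheres -/

section MovingSpheres

lemma integrableOn_kernel_sub_ball (k : ℕ) (x : EuclideanSpace ℝ (Fin (k + 4))) (r : ℝ) :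
    IntegrableOn (fun z => (‖x - z‖ ^ k)⁻¹) (ball 0 r) := by
  have h := (measurePreserving_sub_right (volume : Measure (EuclideanSpace ℝ (Fin (k + 4)))) x)
    |>.integrableOn_comp_preimage (measurableEmbedding_subRight x)
      (f := fun z => (‖z‖ ^ k)⁻¹) (s := ball 0 (r + ‖x‖))
  have h' := h.2 (integrableOn_norm_pow_inv_ball k _)
  refine (h'.mono_set fun z hz => ?_).congr_fun (fun z _ => ?_) measurableSet_ball
  · rw [Set.mem_preimage, mem_ball_zero_iff] at *
    exact (norm_sub_le z x).trans_lt (by linarith)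
  · simp only [Function.comp_apply, norm_sub_rev]

lemma exists_setIntegral_kernel_le (k : ℕ) (r : ℝ) {ε : ℝ} (hε : 0 < ε) :
    ∃ δ > 0, ∀ x : EuclideanSpace ℝ (Fin (k + 4)), ‖x‖ < r → ∀ B ⊆ ball 0 r, volume B < δ →
      ∫ z in B, (‖x - z‖ ^ k)⁻¹ ≤ ε := by
  set g : EuclideanSpace ℝ (Fin (k + 4)) → ℝ :=
    (ball 0 (2 * r)).indicator fun z => (‖z‖ ^ k)⁻¹ with hg
  have hgi : Integrable g :=
    (integrable_indicator_iff measurableSet_ball).2 (integrableOn_norm_pow_inv_ball k _)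
  have hg0 : ∀ z, 0 ≤ g z := fun z => Set.indicator_nonneg (fun z _ => by positivity) z
  obtain ⟨δ, hδ, H⟩ := exists_pos_setLIntegral_lt_of_measure_lt
    hgi.lintegral_lt_top.ne (ENNReal.ofReal_pos.2 hε).ne'
  refine ⟨δ, hδ, fun x hx B hB hBδ => ?_⟩
  set s := (fun z => z + x) ⁻¹' B with hs
  have h1 : ∫ z in B, (‖x - z‖ ^ k)⁻¹ = ∫ z in s, (‖z‖ ^ k)⁻¹ := by
    rw [← (measurePreserving_sub_right (volume : Measure (EuclideanSpace ℝ (Fin (k + 4)))) x)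
      |>.setIntegral_preimage_emb (measurableEmbedding_subRight x) (fun z => (‖z‖ ^ k)⁻¹) s]
    simp_rw [norm_sub_rev x]
    congr 2
    ext z
    simp [hs]
  have h2 : ∫ z in s, (‖z‖ ^ k)⁻¹ ≤ ∫ z in s, g z := by
    refine le_of_eq (integral_congr_ae ?_)
    have hsub : s ⊆ ball 0 (2 * r) := fun z hz => by
      have h3 := mem_ball_zero_iff.1 (hB hz)
      have h4 := norm_sub_le (z + x) x
      rw [add_sub_cancel_right] at h4
      rw [mem_ball_zero_iff]
      linarith
    filter_upwards [ae_restrict_of_ae_restrict_of_subset hsub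
      (ae_restrict_mem measurableSet_ball)] with z hz
    rw [hg, Set.indicator_of_mem hz]
  have h3 : volume s < δ := by
    rw [hs, measure_preimage_add_right]
    exact hBδ
  rw [h1]
  refine h2.trans ?_
  rw [integral_eq_lintegral_of_nonneg_ae (ae_of_all _ hg0) hgi.aestronglyMeasurable.restrict]
  exact ENNReal.toReal_le_of_le_ofReal hε.le (H s h3).le

lemma rpow_sub_rpow_le {p v w : ℝ} (hp : 1 ≤ p) (hv : 0 < v) (hw : 0 ≤ w) :
    v ^ p - w ^ p ≤ p * v ^ (p - 1) * (v - w) := by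
  have h := one_add_mul_self_le_rpow_one_add (s := w / v - 1)
    (by linarith [div_nonneg hw hv.le]) hp
  rw [add_sub_cancel, Real.div_rpow hw hv.le, le_div_iff₀ (by positivity)] at h
  have e : v ^ p = v ^ (p - 1) * v := by rw [← Real.rpow_add_one hv.ne', sub_add_cancel]
  have h2 : (1 + p * (w / v - 1)) * v ^ p = v ^ p - p * v ^ (p - 1) * (v - w) := by
    rw [e]
    field_simp
    ring
  linarith

variable {k : ℕ} {p : ℝ} {u : EuclideanSpace ℝ (Fin (k + 4)) → ℝ}

/-- The set where a function exceeds its Kelvin transform. -/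
def kelvinBad (u : EuclideanSpace ℝ (Fin (k + 4)) → ℝ) (r : ℝ) :
    Set (EuclideanSpace ℝ (Fin (k + 4))) :=
  {z | z ∈ pball (k + 4) r ∧ kelvin u r z < u z}

lemma measurableSet_kelvinBad (hu : Continuous u) (r : ℝ) : MeasurableSet (kelvinBad u r) := by
  refine (measurableSet_pball r).inter (measurableSet_lt ?_ hu.measurable)
  unfold kelvin
  exact ((measurable_const.div measurable_norm).pow_const k).mul
    (hu.measurable.comp (measurable_inv₀ r))

lemma kelvinBad_subset (u : EuclideanSpace ℝ (Fin (k + 4)) → ℝ) {r R : ℝ} (hr : r ≤ R) :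
    kelvinBad u r ⊆ ball 0 R := fun _ hz => mem_ball_zero_iff.2 (hz.1.2.trans_le hr)

lemma kelvin_nonneg (h0 : ∀ x, 0 ≤ u x) {r : ℝ} (hr : 0 ≤ r) (z : EuclideanSpace ℝ (Fin (k + 4))) :
    0 ≤ kelvin u r z := mul_nonneg (by positivity) (h0 _)

/-- Subcriticality makes the Kelvin transform a strict supersolution inside the ball. -/
lemma kelvin_rpow_lt (hkp : k * p < k + 8) (hu : ∀ x, 0 < u x) {r : ℝ}
    {z : EuclideanSpace ℝ (Fin (k + 4))} (hz : z ∈ pball (k + 4) r) :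
    kelvin u r z ^ p < (r / ‖z‖) ^ (k + 8) * u (inv₀ r z) ^ p := by
  have h1 : 1 < r / ‖z‖ := (one_lt_div hz.1).2 hz.2
  have h2 : 0 < r / ‖z‖ := by linarith
  rw [kelvin, Real.mul_rpow (by positivity) (hu _).le]
  refine mul_lt_mul_of_pos_right ?_ (Real.rpow_pos_of_pos (hu _) _)
  rw [← Real.rpow_natCast, ← Real.rpow_mul h2.le, ← Real.rpow_natCast]
  refine Real.rpow_lt_rpow_of_exponent_lt h1 ?_
  push_cast
  exact hkp

variable {c : ℝ}

lemma lt_kelvin_of_kelvinBad_eq_empty (hk : 1 ≤ k) (hc : 0 < c) (hp : 1 < p)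
    (hkp : k * p < k + 8) (hu : ∀ x, 0 < u x)
    (hrep : ∀ x, Integrable (fun y => (‖x - y‖ ^ k)⁻¹ * u y ^ p) ∧
      c * u x = ∫ y, (‖x - y‖ ^ k)⁻¹ * u y ^ p) {r : ℝ} (hB : kelvinBad u r = ∅)
    {x : EuclideanSpace ℝ (Fin (k + 4))} (hx : x ∈ pball (k + 4) r) : u x < kelvin u r x := by
  obtain ⟨hi, h⟩ := sub_kelvin_eq_integral hrep hx
  have hr : 0 < r := hx.1.trans hx.2
  have hneg : ∀ᵐ z ∂(volume.restrict (pball (k + 4) r)),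
      ((‖x - z‖ ^ k)⁻¹ - reflectedKernel k r x z) *
      (u z ^ p - (r / ‖z‖) ^ (k + 8) * u (inv₀ r z) ^ p) < 0 := by
    have h0 : ∀ᵐ z ∂(volume : Measure (EuclideanSpace ℝ (Fin (k + 4)))), z ≠ x :=
      Measure.ae_ne volume x
    filter_upwards [ae_restrict_mem (measurableSet_pball r), ae_restrict_of_ae h0] with z hz hzx
    have h1 : u z ≤ kelvin u r z := by
      by_contra hcon
      exact (hB ▸ (show z ∈ kelvinBad u r from ⟨hz, not_le.1 hcon⟩) : z ∈ (∅ : Set _))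
    have h2 := Real.rpow_le_rpow (hu z).le h1 (by linarith : 0 ≤ p)
    have h3 := kelvin_rpow_lt hkp hu hz
    exact mul_neg_of_pos_of_neg (sub_pos.2 (reflectedKernel_lt hk hx hz hzx.symm))
      (by linarith)
  have hlt : ∫ z in pball (k + 4) r, ((‖x - z‖ ^ k)⁻¹ - reflectedKernel k r x z) *
      (u z ^ p - (r / ‖z‖) ^ (k + 8) * u (inv₀ r z) ^ p) < 0 := by
    have hpos := (integral_pos_iff_support_of_nonneg_ae (f := fun z =>
      -(((‖x - z‖ ^ k)⁻¹ - reflectedKernel k r x z) *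
      (u z ^ p - (r / ‖z‖) ^ (k + 8) * u (inv₀ r z) ^ p)))
      (hneg.mono fun z hz => (neg_pos.2 hz).le) hi.neg).2 ?_
    · rw [integral_neg] at hpos
      linarith
    · have hsupp : (Function.support fun z => -(((‖x - z‖ ^ k)⁻¹ - reflectedKernel k r x z) *
          (u z ^ p - (r / ‖z‖) ^ (k + 8) * u (inv₀ r z) ^ p))) =ᵐ[volume.restrict
            (pball (k + 4) r)] Set.univ :=
        eventuallyEq_univ.2 (hneg.mono fun z hz => (neg_pos.2 hz).ne')
      rw [measure_congr hsupp, Measure.restrict_apply_univ]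
      refine lt_of_lt_of_le ?_ (measure_mono (show ball x (min ‖x‖ (r - ‖x‖)) ⊆ _ from ?_))
      · exact measure_ball_pos _ _ (lt_min hx.1 (sub_pos.2 hx.2))
      · intro z hz
        rw [mem_ball, dist_eq_norm, lt_min_iff] at hz
        have t1 := norm_sub_norm_le x z
        have t2 := norm_sub_norm_le z x
        rw [norm_sub_rev] at t1
        exact ⟨by linarith [hz.1], by linarith [hz.2]⟩
  rw [← h] at hlt
  have := neg_of_mul_neg_right hlt hc.le
  linarith

lemma exists_kelvinBad_eq_empty_of_volume_lt (hk : 1 ≤ k) (hc : 0 < c) (hp : 1 < p)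
    (hkp : k * p < k + 8) (huc : Continuous u) (hu : ∀ x, 0 < u x)
    (hrep : ∀ x, Integrable (fun y => (‖x - y‖ ^ k)⁻¹ * u y ^ p) ∧
      c * u x = ∫ y, (‖x - y‖ ^ k)⁻¹ * u y ^ p) (R : ℝ) :
    ∃ δ > 0, ∀ r ≤ R, volume (kelvinBad u r) < δ → kelvinBad u r = ∅ := by
  obtain ⟨K, hK⟩ := (isCompact_closedBall (0 : EuclideanSpace ℝ (Fin (k + 4)))
    R).exists_bound_of_continuousOn huc.continuousOn
  have hK' : ∀ z, ‖z‖ ≤ R → u z ≤ max K 1 := fun z hz =>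
    (le_abs_self _).trans ((hK z (mem_closedBall_zero_iff.2 hz)).trans (le_max_left _ _))
  set D := p * max K 1 ^ (p - 1) with hD
  have hm : 0 < max K 1 := lt_max_of_lt_right one_pos
  have hD0 : 0 < D := mul_pos (by linarith) (Real.rpow_pos_of_pos hm _)
  obtain ⟨δ, hδ, H⟩ := exists_setIntegral_kernel_le k R (ε := c / (2 * D)) (by positivity)
  refine ⟨δ, hδ, fun r hr hvol => ?_⟩
  by_contra hne
  obtain ⟨x₁, hx₁⟩ := Set.nonempty_iff_ne_empty.2 hne
  set S := (fun z => u z - kelvin u r z) '' kelvinBad u r with hS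
  have hbdd : BddAbove S := by
    refine ⟨max K 1, ?_⟩
    rintro _ ⟨z, hz, rfl⟩
    have := kelvin_nonneg (fun x => (hu x).le) (hz.1.1.trans hz.1.2).le z
    have := hK' z (hz.1.2.le.trans hr)
    simp only
    linarith
  set M := sSup S with hM
  have hle : ∀ z ∈ kelvinBad u r, u z - kelvin u r z ≤ M := fun z hz =>
    le_csSup hbdd ⟨z, hz, rfl⟩
  have hM0 : 0 < M := (sub_pos.2 hx₁.2).trans_le (hle x₁ hx₁)
  have hhalf : M ≤ M / 2 := by
    refine csSup_le ⟨_, x₁, hx₁, rfl⟩ ?_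
    rintro _ ⟨x, hx, rfl⟩
    obtain ⟨hi, h⟩ := sub_kelvin_eq_integral hrep hx.1
    have hr0 : 0 < r := hx.1.1.trans hx.1.2
    have hBi : IntegrableOn (fun z => (‖x - z‖ ^ k)⁻¹ * (D * M)) (kelvinBad u r) :=
      ((integrableOn_kernel_sub_ball k x R).mono_set (kelvinBad_subset u hr)).mul_const _
    have hup : ∫ z in pball (k + 4) r, ((‖x - z‖ ^ k)⁻¹ - reflectedKernel k r x z) *
        (u z ^ p - (r / ‖z‖) ^ (k + 8) * u (inv₀ r z) ^ p) ≤
        ∫ z in pball (k + 4) r, (kelvinBad u r).indicator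
          (fun z => (‖x - z‖ ^ k)⁻¹ * (D * M)) z := by
      refine setIntegral_mono_ae_restrict hi
        ((integrable_indicator_iff (measurableSet_kelvinBad huc r)).2 hBi).integrableOn ?_
      have h0 : ∀ᵐ z ∂(volume : Measure (EuclideanSpace ℝ (Fin (k + 4)))), z ≠ x :=
        Measure.ae_ne volume x
      filter_upwards [ae_restrict_mem (measurableSet_pball r), ae_restrict_of_ae h0] with z hz hzx
      have h3 := kelvin_rpow_lt hkp hu hz
      have h4 := reflectedKernel_lt hk hx.1 hz hzx.symm
      have h5 := reflectedKernel_nonneg k hr0 x z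
      by_cases hzB : z ∈ kelvinBad u r
      · rw [Set.indicator_of_mem hzB]
        have h6 := rpow_sub_rpow_le hp.le (hu z) (kelvin_nonneg (fun x => (hu x).le) hr0.le z)
        have h7 : p * u z ^ (p - 1) * (u z - kelvin u r z) ≤ D * M := by
          refine mul_le_mul ?_ (hle z hzB) (sub_pos.2 hzB.2).le hD0.le
          refine mul_le_mul_of_nonneg_left ?_ (by linarith)
          exact Real.rpow_le_rpow (hu z).le (hK' z (hz.2.le.trans hr)) (by linarith)
        refine (mul_le_mul_of_nonneg_left (?_ : _ ≤ D * M) (sub_pos.2 h4).le).trans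
          (mul_le_mul_of_nonneg_right (by linarith) (by positivity))
        linarith
      · rw [Set.indicator_of_notMem hzB]
        have h1 : u z ≤ kelvin u r z := not_lt.1 fun hcon => hzB ⟨hz, hcon⟩
        have h2 := Real.rpow_le_rpow (hu z).le h1 (by linarith : 0 ≤ p)
        exact mul_nonpos_of_nonneg_of_nonpos (by linarith) (by linarith)
    rw [setIntegral_indicator (measurableSet_kelvinBad huc r),
      Set.inter_eq_self_of_subset_right (fun z hz => hz.1), integral_mul_const, ← h] at hup
    have hs := H x (hx.1.2.trans_le hr) _ (kelvinBad_subset u hr) hvol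
    have h8 := hup.trans (mul_le_mul_of_nonneg_right hs (by positivity))
    have h9 : c / (2 * D) * (D * M) = c * (M / 2) := by field_simp
    rw [h9] at h8
    exact le_of_mul_le_mul_left h8 hc
  linarith

end MovingSpheres

/-! ### Continuation in the radius and conclusion -/

section Conclusion

variable {k : ℕ} {p c : ℝ} {u : EuclideanSpace ℝ (Fin (k + 4)) → ℝ}

lemma continuous_kelvin_radius (huc : Continuous u) (z : EuclideanSpace ℝ (Fin (k + 4))) :
    Continuous fun r => kelvin u r z := by
  unfold kelvin inv₀
  fun_prop

lemma eventually_volume_kelvinBad_lt (huc : Continuous u) {r₀ : ℝ} (hr₀ : 0 < r₀)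
    (hlt : ∀ x ∈ pball (k + 4) r₀, u x < kelvin u r₀ x) {δ : ENNReal} (hδ : 0 < δ) :
    ∀ᶠ r in nhds r₀, volume (kelvinBad u r) < δ := by
  have h : Tendsto (fun r => volume (kelvinBad u r)) (nhds r₀)
      (nhds (volume (∅ : Set (EuclideanSpace ℝ (Fin (k + 4)))))) := by
    refine tendsto_measure_of_ae_tendsto_indicator _ MeasurableSet.empty
      (measurableSet_kelvinBad huc) (B := ball 0 (r₀ + 1)) measurableSet_ball
      measure_ball_lt_top.ne ?_ ?_
    · filter_upwards [eventually_le_nhds (show r₀ < r₀ + 1 by linarith)] with r hr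
      exact kelvinBad_subset u hr
    · have s2 : ∀ᵐ z : EuclideanSpace ℝ (Fin (k + 4)), z ∉ sphere 0 r₀ :=
        measure_eq_zero_iff_ae_notMem.1 (Measure.addHaar_sphere_of_ne_zero volume 0 hr₀.ne')
      filter_upwards [s2] with z hz
      rw [mem_sphere_zero_iff_norm] at hz
      rcases lt_or_gt_of_ne hz with hz | hz
      · by_cases hz0 : z = 0
        · refine Eventually.of_forall fun r => iff_of_false (fun hm => ?_) (fun hm => hm)
          exact ne_zero_of_mem_pball hm.1 hz0
        · have h1 := hlt z ⟨norm_pos_iff.2 hz0, hz⟩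
          filter_upwards [(continuous_kelvin_radius huc z).continuousAt.eventually
            (lt_mem_nhds h1)] with r hr
          exact iff_of_false (fun hm => (hm.2.trans hr).false) (fun hm => hm)
      · filter_upwards [eventually_lt_nhds hz] with r hr
        exact iff_of_false (fun hm => (hm.1.2.trans hr).false) (fun hm => hm)
  rw [measure_empty] at h
  exact h.eventually (gt_mem_nhds hδ)

/-- Moving spheres reach every radius: a solution lies below its Kelvin transforms. -/
lemma le_kelvin (hk : 1 ≤ k) (hc : 0 < c) (hp : 1 < p)
    (hkp : k * p < k + 8) (huc : Continuous u) (hu : ∀ x, 0 < u x)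
    (hrep : ∀ x, Integrable (fun y => (‖x - y‖ ^ k)⁻¹ * u y ^ p) ∧
      c * u x = ∫ y, (‖x - y‖ ^ k)⁻¹ * u y ^ p) {r : ℝ} {z : EuclideanSpace ℝ (Fin (k + 4))}
    (hz : z ∈ pball (k + 4) r) : u z ≤ kelvin u r z := by
  have hr : 0 < r := hz.1.trans hz.2
  obtain ⟨δ, hδ, H⟩ := exists_kelvinBad_eq_empty_of_volume_lt hk hc hp hkp huc hu hrep (r + 1)
  have hbad : ∀ s, kelvinBad u s = ∅ ↔
      ∀ x : EuclideanSpace ℝ (Fin (k + 4)), x = 0 ∨ s ≤ ‖x‖ ∨ u x ≤ kelvin u s x := by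
    intro s
    rw [Set.eq_empty_iff_forall_notMem]
    refine forall_congr' fun x => ?_
    rw [kelvinBad, pball, Set.mem_ofPred_eq, Set.mem_ofPred_eq, norm_pos_iff, ← not_le, ← not_le]
    tauto
  obtain ⟨s, hs0, hsr, hs⟩ : ∃ s, 0 < s ∧ s ≤ r ∧ kelvinBad u s = ∅ := by
    have h1 : Tendsto (fun s : ℝ => ENNReal.ofReal (s ^ (k + 4)) *
        volume (ball (0 : EuclideanSpace ℝ (Fin (k + 4))) 1)) (nhdsWithin 0 (Set.Ioi 0))
        (nhds 0) := by
      have h2 : Tendsto (fun s : ℝ => ENNReal.ofReal (s ^ (k + 4))) (nhds 0) (nhds 0) := by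
        have := (ENNReal.continuous_ofReal.comp (continuous_pow (M := ℝ) (k + 4))).tendsto 0
        simpa [Function.comp_def] using this
      have h3 := ENNReal.Tendsto.mul_const
        (b := volume (ball (0 : EuclideanSpace ℝ (Fin (k + 4))) 1)) h2
        (Or.inr measure_ball_lt_top.ne)
      rw [zero_mul] at h3
      exact h3.mono_left nhdsWithin_le_nhds
    have h4 : ∀ᶠ s : ℝ in nhdsWithin 0 (Set.Ioi 0), s ≤ r :=
      nhdsWithin_le_nhds (eventually_le_nhds hr)
    obtain ⟨s, hs1, hs2, hs3⟩ :=
      ((h1.eventually (gt_mem_nhds hδ)).and (h4.and self_mem_nhdsWithin)).exists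
    have hs3 : 0 < s := hs3
    refine ⟨s, hs3, hs2, H s (by linarith) ?_⟩
    refine (measure_mono (kelvinBad_subset u le_rfl)).trans_lt ?_
    rw [Measure.addHaar_ball volume _ hs3.le, finrank_euclideanSpace, Fintype.card_fin]
    exact hs1
  have hsub : Set.Icc s r ⊆ {s | kelvinBad u s = ∅} := by
    refine IsClosed.Icc_subset_of_forall_mem_nhdsWithin ?_ hs ?_
    · refine IsClosed.inter ?_ isClosed_Icc
      simp only [hbad, Set.ofPred_forall]
      refine isClosed_iInter fun x => ?_
      refine isClosed_const.union ((isClosed_le continuous_id continuous_const).union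
        (isClosed_le continuous_const (continuous_kelvin_radius huc x)))
    · rintro t ⟨ht, ht2⟩
      have ht0 : 0 < t := hs0.trans_le ht2.1
      have h5 := eventually_volume_kelvinBad_lt huc ht0
        (fun x hx => lt_kelvin_of_kelvinBad_eq_empty hk hc hp hkp hu hrep ht hx) hδ
      refine nhdsWithin_le_nhds ?_
      filter_upwards [h5, eventually_le_nhds (show t < r + 1 by linarith [ht2.2])] with q hq hqr
      exact H q hqr hq
  have hfin := (hbad r).1 (hsub ⟨hsr, le_rfl⟩) z
  rcases hfin with h | h | h
  · exact absurd h (ne_zero_of_mem_pball hz)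
  · exact absurd hz.2 (not_lt.2 h)
  · exact h

lemma rpow_mul_le_of_one_lt (hk : 1 ≤ k) (hc : 0 < c) (hp : 1 < p)
    (hkp : k * p < k + 8) (huc : Continuous u) (hu : ∀ x, 0 < u x)
    (hrep : ∀ x, Integrable (fun y => (‖x - y‖ ^ k)⁻¹ * u y ^ p) ∧
      c * u x = ∫ y, (‖x - y‖ ^ k)⁻¹ * u y ^ p) {R : ℝ} (hR : 1 < R)
    {z : EuclideanSpace ℝ (Fin (k + 4))} (hz : z ≠ 0) : u z ≤ R ^ (k / 2 : ℝ) * u (R • z) := by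
  have hz0 : 0 < ‖z‖ := norm_pos_iff.2 hz
  have h1 : 1 < √R := Real.lt_sqrt_of_sq_lt (by simpa using hR)
  have h := le_kelvin hk hc hp hkp huc hu hrep (r := √R * ‖z‖) (z := z)
    ⟨hz0, lt_mul_of_one_lt_left hz0 h1⟩
  rw [kelvin, inv₀, mul_div_cancel_right₀ _ hz0.ne', Real.sq_sqrt (by linarith)] at h
  refine h.trans_eq ?_
  rw [Real.sqrt_eq_rpow, ← Real.rpow_mul_natCast (by linarith)]
  congr 2
  ring

lemma pos_of_riesz_representation (hp : 1 < p) (huc : Continuous u) (h0 : ∀ x, 0 ≤ u x)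
    (hrep : ∀ x, Integrable (fun y => (‖x - y‖ ^ k)⁻¹ * u y ^ p) ∧
      c * u x = ∫ y, (‖x - y‖ ^ k)⁻¹ * u y ^ p) {x₀ : EuclideanSpace ℝ (Fin (k + 4))}
    (hx₀ : u x₀ ≠ 0) (x : EuclideanSpace ℝ (Fin (k + 4))) : 0 < u x := by
  refine (h0 x).lt_of_ne' fun hx => ?_
  have h := (hrep x).2
  rw [hx, mul_zero, eq_comm, integral_eq_zero_iff_of_nonneg
    (fun y => mul_nonneg (by positivity) (Real.rpow_nonneg (h0 y) _)) (hrep x).1] at h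
  have hne : ∀ᵐ z ∂(volume : Measure (EuclideanSpace ℝ (Fin (k + 4)))), z ≠ x :=
    Measure.ae_ne volume x
  have hz : u =ᵐ[volume] fun _ => 0 := by
    filter_upwards [h, hne] with y hy hyx
    have : 0 < ‖x - y‖ := norm_pos_iff.2 (sub_ne_zero.2 hyx.symm)
    have h2 := (mul_eq_zero.1 hy).resolve_left (by positivity)
    exact (Real.rpow_eq_zero (h0 y) (by linarith)).1 h2
  exact hx₀ (congrFun (Continuous.ae_eq_iff_eq volume huc continuous_const |>.1 hz) x₀)

lemma eq_zero_of_bilap_eq_rpow (hk : 1 ≤ k) (hp : 1 < p) (hkp : k * p < k + 8)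
    (hu : ContDiff ℝ 4 u) (h0 : ∀ x, 0 ≤ u x) (he : ∀ x, bilap u x = u x ^ p)
    (x : EuclideanSpace ℝ (Fin (k + 4))) : u x = 0 := by
  by_contra hx
  obtain ⟨c, hc, hrep⟩ := exists_riesz_representation hk hp
  replace hrep := hrep u hu h0 he
  have huc := hu.continuous
  have hpos := pos_of_riesz_representation hp huc h0 hrep hx
  obtain ⟨C, hC, H⟩ := exists_integral_rescale_le (k + 4) hp
  replace H := H u hu h0 he
  have hloc : ∀ w : EuclideanSpace ℝ (Fin (k + 4)) → ℝ, Continuous w →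
      IntegrableOn w (ball 0 (1 / 2)) := fun w hw =>
    (hw.continuousOn.integrableOn_compact (isCompact_closedBall 0 (1 / 2))).mono_set
      ball_subset_closedBall
  set I := ∫ x in ball 0 (1 / 2), u x with hI
  have hI0 : 0 < I := by
    refine (setIntegral_pos_iff_support_of_nonneg_ae (ae_of_all _ h0) (hloc u huc)).2 ?_
    rw [(Set.eq_univ_of_forall fun z => (hpos z).ne' : Function.support u = Set.univ),
      Set.univ_inter]
    exact measure_ball_pos _ _ (by norm_num)
  set a := 4 / (p - 1) - k / 2 with ha
  have ha0 : 0 < a := by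
    rw [ha, sub_pos, div_lt_div_iff₀ two_pos (by linarith)]
    linarith
  have hbound : ∀ R : ℝ, 1 < R → R ^ a * I ≤ C := fun R hR => by
    have hR0 : 0 < R := by linarith
    refine le_trans ?_ (H R hR0 0)
    rw [hI, ← integral_const_mul]
    refine setIntegral_mono_ae ((hloc u huc).const_mul _) (hloc _ (by fun_prop)) ?_
    have hne : ∀ᵐ z ∂(volume : Measure (EuclideanSpace ℝ (Fin (k + 4)))), z ≠ 0 :=
      Measure.ae_ne volume 0
    filter_upwards [hne] with z hz
    have h1 := rpow_mul_le_of_one_lt hk hc hp hkp huc hpos hrep hR hz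
    have h2 : R ^ (4 / (p - 1)) = R ^ a * R ^ (k / 2 : ℝ) := by
      rw [← Real.rpow_add hR0, ha, sub_add_cancel]
    rw [add_zero, h2, mul_assoc]
    exact mul_le_mul_of_nonneg_left h1 (by positivity)
  have hlim := (tendsto_rpow_atTop ha0).atTop_mul_const hI0
  obtain ⟨R, hR1, hR2⟩ := ((eventually_gt_atTop 1).and (hlim.eventually_gt_atTop C)).exists
  exact (hbound R hR1).not_gt hR2

end Conclusion

/-- (Liouville theorem, Lin) Any nonnegative `C⁴` solution of `Δ²u = u^p` in
all of `ℝⁿ`, `n ≥ 5`, `1 < p < (n+4)/(n-4)`, is identically zero. -/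
theorem stmt_1 (n : ℕ) (hn : 5 ≤ n) (p : ℝ)
    (hp1 : 1 < p) (hp2 : p < ((n : ℝ) + 4) / ((n : ℝ) - 4))
    (u : EuclideanSpace ℝ (Fin n) → ℝ)
    (hreg : ContDiff ℝ 4 u)
    (hpos : ∀ x, 0 ≤ u x)
    (heq : ∀ x, bilap u x = u x ^ p) :
    ∀ x, u x = 0 := by
  obtain ⟨k, rfl⟩ : ∃ k, n = k + 4 := ⟨n - 4, by omega⟩
  have hk : 1 ≤ k := by omega
  have hk0 : (0 : ℝ) < k := by exact_mod_cast hk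
  refine eq_zero_of_bilap_eq_rpow hk hp1 ?_ hreg hpos heq
  push_cast at hp2
  rw [add_sub_cancel_right, lt_div_iff₀ hk0] at hp2
  linarith
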